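/- arXiv:1910.13633 — 4 statements merged into one kernel-verified Lean document; each statement's English description precedes it below -/
import Mathlib

section
/- Sufficiency (Theorem 1, 'if' direction; Lemma A.3): In any disclosure game, if a function V : E → ℝ satisfies the Theorem-1 conditions, then there exists a truth-leaning equilibrium whose sender's value function equals V. -/
open scoped BigOperators

universe u

/-- A disclosure game: a countable evidence space `E` with a disclosure rule
(a preorder `r`, where `r m e` means message `m` is feasible for endowment `e`)
satisfying the lower-bound condition (A4′), a prior `π0 ∈ (0,1)`, evidence
distributions `FG`, `FB` in each state, and a strictly increasing receiver
response `φ` on `[0,1]`. -/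
structure DGame (E : Type u) where
  r : E → E → Prop
  r_refl : ∀ e, r e e
  r_trans : ∀ {a b c : E}, r a b → r b c → r a c
  a4 : ∀ f : ℕ → E, (∀ n, r (f (n + 1)) (f n)) → ∃ N, ∀ n ≥ N, r (f N) (f n)
  π0 : ℝ
  π0_pos : 0 < π0
  π0_lt_one : π0 < 1
  FG : E → ℝ
  FB : E → ℝ
  FG_nonneg : ∀ e, 0 ≤ FG e
  FB_nonneg : ∀ e, 0 ≤ FB e
  FG_hasSum : HasSum FG 1
  FB_hasSum : HasSum FB 1
  FGB_pos : ∀ e, 0 < FG e + FB e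
  φ : ℝ → ℝ
  φ_mono : StrictMonoOn φ (Set.Icc (0 : ℝ) 1)

namespace DGame

variable {E : Type u} (G : DGame E)

/-- The posterior belief `ν(A)` that the state is good conditional on the
evidence lying in `A`. -/
noncomputable def nu (A : Set E) : ℝ :=
  ((∑' e : A, G.FG e) * G.π0) /
    ((∑' e : A, G.FG e) * G.π0 + (∑' e : A, G.FB e) * (1 - G.π0))

/-- `ξ(A) = φ(ν(A))`. -/
noncomputable def xi (A : Set E) : ℝ := G.φ (G.nu A)

/-- `L` is a (nonempty) lower contour set in `A`. -/
def IsLCS (A L : Set E) : Prop :=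
  L.Nonempty ∧ L ⊆ A ∧ ∀ e ∈ L, ∀ e' ∈ A, G.r e' e → e' ∈ L

/-- The Theorem-1 conditions on a candidate value function `V`. -/
def Thm1Conds (V : E → ℝ) : Prop :=
  (∀ e e', G.r e e' → V e ≤ V e') ∧
  (∀ x ∈ Set.range V, G.xi (V ⁻¹' {x}) = x) ∧
  (∀ x ∈ Set.range V, ∀ L : Set E, G.IsLCS (V ⁻¹' {x}) L → x ≤ G.xi L)

/-- A truth-leaning equilibrium `(σ, act, μ)` of the disclosure game. -/
structure Eqm where
  σ : E → E → ℝ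
  act : E → ℝ
  μ : E → ℝ
  σ_nonneg : ∀ e m, 0 ≤ σ e m
  σ_hasSum : ∀ e, HasSum (σ e) 1
  feasible : ∀ e m, 0 < σ e m → G.r m e
  μ_mem : ∀ m, μ m ∈ Set.Icc (0 : ℝ) 1
  sender_opt : ∀ e m, 0 < σ e m → ∀ m', G.r m' e → act m' ≤ act m
  receiver_opt : ∀ m, act m = G.φ (μ m)
  bayes : ∀ m, (∃ e, 0 < σ e m) →
    μ m = (∑' e : {e : E // G.r m e}, σ e.1 m * G.FG e.1 * G.π0) /
      (∑' e : {e : E // G.r m e}, σ e.1 m * (G.FG e.1 * G.π0 + G.FB e.1 * (1 - G.π0)))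
  truth_leaning : ∀ e, (∀ m, G.r m e → act m ≤ act e) → σ e e = 1
  offpath : ∀ m, (¬ ∃ e, 0 < σ e m) → μ m = G.nu {m}

/-- `V` is the sender's value function of the equilibrium `Q`. -/
def IsValueFn (Q : G.Eqm) (V : E → ℝ) : Prop :=
  ∀ e m, 0 < Q.σ e m → V e = Q.act m

end DGame

/-- `T` ships mass along `R` without exceeding the demands `n` and the supplies `p`. -/
structure IsSubplan {α β : Type*} (R : α → β → Prop) (n : α → ℝ) (p : β → ℝ)
    (T : α → β → ℝ) : Prop where
  nonneg : ∀ a b, 0 ≤ T a b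
  eq_zero : ∀ a b, ¬ R a b → T a b = 0
  row_le : ∀ a (F : Finset β), ∑ b ∈ F, T a b ≤ n a
  col_le : ∀ b (F : Finset α), ∑ a ∈ F, T a b ≤ p b

namespace IsSubplan

variable {α β : Type*} {R : α → β → Prop} {n : α → ℝ} {p : β → ℝ} {T : α → β → ℝ}

theorem le_demand (h : IsSubplan R n p T) (a : α) (b : β) : T a b ≤ n a := by
  simpa using h.row_le a {b}

theorem le_supply (h : IsSubplan R n p T) (a : α) (b : β) : T a b ≤ p b := by
  simpa using h.col_le b {a}

theorem summable_row (h : IsSubplan R n p T) (a : α) : Summable (T a) :=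
  summable_of_sum_le (h.nonneg a) (h.row_le a)

theorem summable_col (h : IsSubplan R n p T) (b : β) : Summable fun a => T a b :=
  summable_of_sum_le (fun a => h.nonneg a b) (h.col_le b)

theorem tsum_row_le (h : IsSubplan R n p T) (a : α) : ∑' b, T a b ≤ n a :=
  (h.summable_row a).tsum_le_of_sum_le (h.row_le a)

theorem tsum_col_le (h : IsSubplan R n p T) (b : β) : ∑' a, T a b ≤ p b :=
  (h.summable_col b).tsum_le_of_sum_le (h.col_le b)

theorem tsum_row_nonneg (h : IsSubplan R n p T) (a : α) : 0 ≤ ∑' b, T a b :=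
  tsum_nonneg (h.nonneg a)

theorem summable_tsum_row (h : IsSubplan R n p T) (hn : Summable n) :
    Summable fun a => ∑' b, T a b :=
  hn.of_nonneg_of_le h.tsum_row_nonneg h.tsum_row_le

theorem summable_uncurry (h : IsSubplan R n p T) (hn : Summable n) :
    Summable (Function.uncurry T) :=
  (summable_prod_of_nonneg fun x => h.nonneg x.1 x.2).2
    ⟨h.summable_row, h.summable_tsum_row hn⟩

theorem of_hasSum {r : α → ℝ} {c : β → ℝ} (h0 : ∀ a b, 0 ≤ T a b)
    (hR : ∀ a b, ¬ R a b → T a b = 0) (hr : ∀ a, HasSum (T a) (r a))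
    (hc : ∀ b, HasSum (fun a => T a b) (c b)) (hrn : ∀ a, r a ≤ n a) (hcp : ∀ b, c b ≤ p b) :
    IsSubplan R n p T where
  nonneg := h0
  eq_zero := hR
  row_le a F := (sum_le_hasSum F (fun b _ => h0 a b) (hr a)).trans (hrn a)
  col_le b F := (sum_le_hasSum F (fun a _ => h0 a b) (hc b)).trans (hcp b)

theorem isCompact_setOf (R : α → β → Prop) (n : α → ℝ) (p : β → ℝ) :
    IsCompact {T | IsSubplan R n p T} := by
  have hK : IsCompact (Set.univ.pi fun a : α => Set.univ.pi fun _ : β => Set.Icc 0 (n a)) :=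
    isCompact_univ_pi fun a => isCompact_univ_pi fun _ => isCompact_Icc
  refine hK.of_isClosed_subset ?_ fun T hT a _ b _ => ⟨hT.nonneg a b, hT.le_demand a b⟩
  have : {T | IsSubplan R n p T} =
      {T | ∀ a b, 0 ≤ T a b} ∩ {T | ∀ a b, ¬ R a b → T a b = 0} ∩
      {T | ∀ a (F : Finset β), ∑ b ∈ F, T a b ≤ n a} ∩
      {T | ∀ b (F : Finset α), ∑ a ∈ F, T a b ≤ p b} := by
    ext T
    exact ⟨fun h => ⟨⟨⟨h.1, h.2⟩, h.3⟩, h.4⟩, fun h => ⟨h.1.1.1, h.1.1.2, h.1.2, h.2⟩⟩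
  rw [this]
  simp only [Set.ofPred_forall]
  refine ((IsClosed.inter ?_ ?_).inter ?_).inter ?_
  · exact isClosed_iInter fun a => isClosed_iInter fun b =>
      isClosed_le (by fun_prop) (by fun_prop)
  · exact isClosed_iInter fun a => isClosed_iInter fun b => isClosed_iInter fun _ =>
      isClosed_eq (by fun_prop) (by fun_prop)
  · exact isClosed_iInter fun a => isClosed_iInter fun F =>
      isClosed_le (by fun_prop) (by fun_prop)
  · exact isClosed_iInter fun a => isClosed_iInter fun F =>
      isClosed_le (by fun_prop) (by fun_prop)

theorem continuousOn_tsum_row (hp : Summable p) (a : α) :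
    ContinuousOn (fun T : α → β → ℝ => ∑' b, T a b) {T | IsSubplan R n p T} :=
  continuousOn_tsum (fun b => by fun_prop) hp fun b T hT => by
    rw [Real.norm_of_nonneg (hT.nonneg a b)]
    exact hT.le_supply a b

theorem deficit_sq_le (h : IsSubplan R n p T) (a : α) :
    (n a - ∑' b, T a b) ^ 2 ≤ n a ^ 2 :=
  pow_le_pow_left₀ (sub_nonneg.2 (h.tsum_row_le a)) (sub_le_self _ (h.tsum_row_nonneg a)) 2

theorem summable_deficit_sq (h : IsSubplan R n p T) (hn : Summable fun a => n a ^ 2) :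
    Summable fun a => (n a - ∑' b, T a b) ^ 2 :=
  hn.of_nonneg_of_le (fun _ => sq_nonneg _) h.deficit_sq_le

theorem exists_isMinOn_deficit (hn0 : ∀ a, 0 ≤ n a) (hp0 : ∀ b, 0 ≤ p b)
    (hn : Summable fun a => n a ^ 2) (hp : Summable p) :
    ∃ T, IsSubplan R n p T ∧
      ∀ T', IsSubplan R n p T' →
        ∑' a, (n a - ∑' b, T a b) ^ 2 ≤ ∑' a, (n a - ∑' b, T' a b) ^ 2 := by
  have hne : {T | IsSubplan R n p T}.Nonempty :=
    ⟨fun _ _ => 0, by constructor <;> simp [hn0, hp0]⟩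
  have hcont : ContinuousOn (fun T : α → β → ℝ => ∑' a, (n a - ∑' b, T a b) ^ 2)
      {T | IsSubplan R n p T} :=
    continuousOn_tsum
      (fun a => (continuousOn_const.sub (continuousOn_tsum_row hp a)).pow 2) hn
      fun a T hT => by
        rw [Real.norm_of_nonneg (sq_nonneg _)]
        exact hT.deficit_sq_le a
  obtain ⟨T, hT, hmin⟩ := (isCompact_setOf R n p).exists_isMinOn hne hcont
  exact ⟨T, hT, fun T' hT' => hmin hT'⟩

open Classical in
/-- A plan minimizing the sum of squared deficits leaves no supply unused next to a deficit. -/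
theorem col_eq_of_deficit_pos (h : IsSubplan R n p T) (hn : Summable fun a => n a ^ 2)
    (hmin : ∀ T', IsSubplan R n p T' →
      ∑' a, (n a - ∑' b, T a b) ^ 2 ≤ ∑' a, (n a - ∑' b, T' a b) ^ 2)
    {a : α} {b : β} (hR : R a b) (ha : ∑' b, T a b < n a) : ∑' a, T a b = p b := by
  by_contra hb
  have hb := lt_of_le_of_ne (h.tsum_col_le b) hb
  obtain ⟨ε, hε, hεa, hεb⟩ : ∃ ε, 0 < ε ∧ ε ≤ n a - ∑' b, T a b ∧ ε ≤ p b - ∑' a, T a b :=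
    ⟨min (n a - ∑' b, T a b) (p b - ∑' a, T a b),
      lt_min (sub_pos.2 ha) (sub_pos.2 hb), min_le_left _ _, min_le_right _ _⟩
  let T' : α → β → ℝ := fun a' b' => T a' b' + if a' = a ∧ b' = b then ε else 0
  have hrow : ∀ a', HasSum (T' a') (∑' b, T a' b + if a' = a then ε else 0) := fun a' =>
    (h.summable_row a').hasSum.add (by
      by_cases h' : a' = a <;> simp [h', hasSum_ite_eq, hasSum_zero])
  have hcol : ∀ b', HasSum (fun a' => T' a' b') (∑' a, T a b' + if b' = b then ε else 0) :=
    fun b' => (h.summable_col b').hasSum.add (by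
      by_cases h' : b' = b <;> simp [h', hasSum_ite_eq, hasSum_zero])
  have hT' : IsSubplan R n p T' := by
    refine of_hasSum (fun a' b' => ?_) (fun a' b' hR' => ?_) hrow hcol (fun a' => ?_)
      fun b' => ?_
    · have := h.nonneg a' b'
      dsimp only [T']; split_ifs <;> linarith
    · have : ¬ (a' = a ∧ b' = b) := by rintro ⟨rfl, rfl⟩; exact hR' hR
      simp [T', this, h.eq_zero a' b' hR']
    · have := h.tsum_row_le a'
      split_ifs with h'
      · subst h'; linarith
      · linarith
    · have := h.tsum_col_le b'
      split_ifs with h'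
      · subst h'; linarith
      · linarith
  refine (hmin T' hT').not_gt
    ((hT'.summable_deficit_sq hn).tsum_lt_tsum (i := a) (fun a' => ?_) ?_
      (h.summable_deficit_sq hn))
  · rw [(hrow a').tsum_eq]
    split_ifs with h'
    · subst h'; nlinarith
    · simp
  · rw [(hrow a).tsum_eq, if_pos rfl]
    nlinarith

open Classical in
/-- A plan minimizing the sum of squared deficits serves no demand better than a competing one. -/
theorem deficit_le_of_pos (h : IsSubplan R n p T) (hn : Summable fun a => n a ^ 2)
    (hmin : ∀ T', IsSubplan R n p T' →
      ∑' a, (n a - ∑' b, T a b) ^ 2 ≤ ∑' a, (n a - ∑' b, T' a b) ^ 2)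
    {a a' : α} {b : β} (hT : 0 < T a b) (hR : R a' b) :
    n a' - ∑' b, T a' b ≤ n a - ∑' b, T a b := by
  by_contra! hlt
  have hne : a ≠ a' := by rintro rfl; exact lt_irrefl _ hlt
  set u : α → ℝ := fun a => n a - ∑' b, T a b with hu
  change u a < u a' at hlt
  obtain ⟨ε, hε, hεT, hεu⟩ : ∃ ε, 0 < ε ∧ ε ≤ T a b ∧ 2 * ε ≤ u a' - u a :=
    ⟨min (T a b) ((u a' - u a) / 2), lt_min hT (by linarith), min_le_left _ _, by
      linarith [min_le_right (T a b) ((u a' - u a) / 2)]⟩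
  have hua : 0 ≤ u a := sub_nonneg.2 (h.tsum_row_le a)
  let δ : α → ℝ := fun x => (if x = a' then ε else 0) - if x = a then ε else 0
  let T' : α → β → ℝ := fun x y => T x y + if y = b then δ x else 0
  have hrow : ∀ x, HasSum (T' x) (∑' y, T x y + δ x) := fun x =>
    (h.summable_row x).hasSum.add (hasSum_ite_eq b (δ x))
  have hcol : ∀ y, HasSum (fun x => T' x y) (∑' x, T x y) := fun y => by
    have hδ : HasSum δ 0 := by
      simpa using (hasSum_ite_eq a' ε).sub (hasSum_ite_eq a ε)
    have : HasSum (fun x => if y = b then δ x else 0) 0 := by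
      by_cases h' : y = b <;> simp [h', hδ, hasSum_zero]
    simpa using (h.summable_col y).hasSum.add this
  have hT' : IsSubplan R n p T' := by
    refine of_hasSum (fun x y => ?_) (fun x y hR' => ?_) hrow hcol (fun x => ?_) h.tsum_col_le
    · have := h.nonneg x y
      by_cases hy : y = b
      · subst hy
        by_cases hx : x = a
        · subst hx; simp [T', δ, hne]; linarith
        · simp only [T', δ, hx, if_true, if_false]; split_ifs <;> linarith
      · simp [T', hy, this]
    · have h1 : ¬ (y = b ∧ x = a') := by rintro ⟨rfl, rfl⟩; exact hR' hR
      have h2 : ¬ (y = b ∧ x = a) := by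
        rintro ⟨rfl, rfl⟩; exact hT.ne' (h.eq_zero _ _ hR')
      by_cases hy : y = b
      · simp [T', δ, h.eq_zero x y hR', not_and.1 h1 hy, not_and.1 h2 hy]
      · simp [T', h.eq_zero x y hR', hy]
    · have hx := h.tsum_row_le x
      by_cases h1 : x = a'
      · subst h1
        have : ε ≤ u x := by linarith
        simp [δ, hne.symm]; linarith
      · simp only [δ, h1, if_false]; split_ifs <;> linarith
  have hsq : HasSum (fun x => (n x - ∑' y, T' x y) ^ 2)
      (∑' x, u x ^ 2 + (2 * ε * (u a - u a') + 2 * ε ^ 2)) := by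
    have h1 := ((hasSum_ite_eq a' (ε ^ 2 - 2 * ε * u a')).add
      (hasSum_ite_eq a (ε ^ 2 + 2 * ε * u a)))
    convert (h.summable_deficit_sq hn).hasSum.add h1 using 1
    · funext x
      rw [(hrow x).tsum_eq]
      by_cases h1 : x = a'
      · subst h1; simp [δ, hne.symm, hu]; ring
      · by_cases h2 : x = a
        · subst h2; simp [δ, hne, hu]; ring
        · simp [δ, h1, h2]
    · ring
  have := hmin T' hT'
  rw [hsq.tsum_eq] at this
  nlinarith

end IsSubplan

/-- **Fractional Hall theorem**: if every set of demands can be met by the supplies adjacent to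
it and total demand equals total supply, then some transport plan along `R` clears both. -/
theorem exists_transport_of_hall {α β : Type*} {R : α → β → Prop} {n : α → ℝ} {p : β → ℝ}
    (hn0 : ∀ a, 0 ≤ n a) (hp0 : ∀ b, 0 ≤ p b) (hn : Summable n) (hp : Summable p)
    (htot : ∑' a, n a = ∑' b, p b)
    (hall : ∀ S : Set α, ∑' a, S.indicator n a ≤ ∑' b, {b | ∃ a ∈ S, R a b}.indicator p b) :
    ∃ T : α → β → ℝ, (∀ a b, 0 ≤ T a b) ∧ (∀ a b, ¬ R a b → T a b = 0) ∧
      (∀ a, HasSum (T a) (n a)) ∧ ∀ b, HasSum (fun a => T a b) (p b) := by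
  classical
  have hn2 : Summable fun a => n a ^ 2 := by
    refine (hn.mul_left (∑' a, n a)).of_nonneg_of_le (fun _ => sq_nonneg _) fun a => ?_
    rw [sq]
    exact mul_le_mul_of_nonneg_right (hn.le_tsum a fun x _ => hn0 x) (hn0 a)
  obtain ⟨T, h, hmin⟩ := IsSubplan.exists_isMinOn_deficit (R := R) hn0 hp0 hn2 hp
  have hrow : ∀ a, ∑' b, T a b = n a := by
    by_contra! hex
    obtain ⟨a₀, ha₀⟩ := hex
    have ha₀ := lt_of_le_of_ne (h.tsum_row_le a₀) ha₀
    let S : Set α := {a | n a₀ - ∑' b, T a₀ b ≤ n a - ∑' b, T a b}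
    let B : Set β := {b | ∃ a ∈ S, R a b}
    have hmem : ∀ a b, b ∈ B → T a b ≠ 0 → a ∈ S := by
      rintro a b ⟨a', ha', hR⟩ hT
      exact le_trans ha' (h.deficit_le_of_pos hn2 hmin ((h.nonneg a b).lt_of_ne' hT) hR)
    have hB : ∀ b, B.indicator p b = ∑' a, B.indicator (T a) b := by
      intro b
      by_cases hb : b ∈ B
      · obtain ⟨a, ha, hR⟩ := id hb
        have ha : n a₀ - ∑' b, T a₀ b ≤ n a - ∑' b, T a b := ha
        simp only [Set.indicator_of_mem hb]
        exact (h.col_eq_of_deficit_pos hn2 hmin hR (by linarith)).symm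
      · simp [hb]
    have hle : ∀ a b, B.indicator (T a) b ≤ T a b := fun a b =>
      Set.indicator_le_self' (fun b _ => h.nonneg a b) b
    have hnn : ∀ a b, 0 ≤ B.indicator (T a) b := fun a b =>
      Set.indicator_nonneg (fun b _ => h.nonneg a b) b
    have hs : Summable (Function.uncurry fun a b => B.indicator (T a) b) :=
      (h.summable_uncurry hn).of_nonneg_of_le (fun x => hnn x.1 x.2) fun x => hle x.1 x.2
    have hrs : ∀ a, Summable fun b => B.indicator (T a) b := fun a =>
      (h.summable_row a).of_nonneg_of_le (hnn a) (hle a)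
    have hrowB : ∀ a, ∑' b, B.indicator (T a) b ≤ S.indicator (fun a => ∑' b, T a b) a := by
      intro a
      by_cases ha : a ∈ S
      · rw [Set.indicator_of_mem ha]
        exact (hrs a).tsum_le_tsum (hle a) (h.summable_row a)
      · rw [Set.indicator_of_notMem ha]
        refine le_of_eq ((tsum_congr fun b => ?_).trans tsum_zero)
        by_cases hb : b ∈ B
        · rw [Set.indicator_of_mem hb]
          by_contra hT
          exact ha (hmem a b hb hT)
        · simp [hb]
    refine (hall S).not_gt ?_
    calc ∑' b, B.indicator p b = ∑' b, ∑' a, B.indicator (T a) b := tsum_congr hB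
      _ = ∑' a, ∑' b, B.indicator (T a) b := hs.tsum_comm
      _ < ∑' a, S.indicator n a := by
        refine hs.prod.tsum_lt_tsum (i := a₀) (fun a => (hrowB a).trans ?_) ?_ (hn.indicator S)
        · exact Set.indicator_le_indicator (h.tsum_row_le a)
        · refine (hrowB a₀).trans_lt ?_
          have : a₀ ∈ S := by simp [S]
          simpa [this] using ha₀
  have hcol : ∀ b, ∑' a, T a b = p b := by
    by_contra! hex
    obtain ⟨b₀, hb₀⟩ := hex
    have hb₀ := lt_of_le_of_ne (h.tsum_col_le b₀) hb₀
    have hlt : ∑' b, ∑' a, T a b < ∑' b, p b :=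
      (hp.of_nonneg_of_le (fun b => tsum_nonneg fun a => h.nonneg a b)
        h.tsum_col_le).tsum_lt_tsum h.tsum_col_le hb₀ hp
    rw [(h.summable_uncurry hn).tsum_comm, tsum_congr hrow] at hlt
    exact hlt.ne htot
  exact ⟨T, h.nonneg, h.eq_zero, fun a => hrow a ▸ (h.summable_row a).hasSum,
    fun b => hcol b ▸ (h.summable_col b).hasSum⟩

namespace DGame

variable {E : Type u} (G : DGame E)

theorem nu_eq_indicator (A : Set E) :
    G.nu A = ((∑' e, A.indicator G.FG e) * G.π0) /
      ((∑' e, A.indicator G.FG e) * G.π0 + (∑' e, A.indicator G.FB e) * (1 - G.π0)) := by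
  rw [nu, tsum_subtype, tsum_subtype]

theorem nu_mem_Icc (A : Set E) : G.nu A ∈ Set.Icc (0 : ℝ) 1 := by
  have hg : 0 ≤ (∑' e : A, G.FG e) * G.π0 :=
    mul_nonneg (tsum_nonneg fun e => G.FG_nonneg e) G.π0_pos.le
  have hb : 0 ≤ (∑' e : A, G.FB e) * (1 - G.π0) :=
    mul_nonneg (tsum_nonneg fun e => G.FB_nonneg e) (sub_pos.2 G.π0_lt_one).le
  exact ⟨div_nonneg hg (add_nonneg hg hb), div_le_one_of_le₀ (by linarith) (add_nonneg hg hb)⟩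

theorem mass_pos (e : E) : 0 < G.FG e * G.π0 + G.FB e * (1 - G.π0) := by
  have hπ := G.π0_pos
  have hπ' := sub_pos.2 G.π0_lt_one
  rcases (G.FG_nonneg e).eq_or_lt with h | h
  · have := G.FGB_pos e
    rw [← h, zero_add] at this
    rw [← h, zero_mul, zero_add]
    positivity
  · have := G.FB_nonneg e
    positivity

/-- The gain in good-state mass from evidence `e` relative to holding the belief at `c`. -/
noncomputable def surplus (c : ℝ) (e : E) : ℝ :=
  G.FG e * G.π0 - c * (G.FG e * G.π0 + G.FB e * (1 - G.π0))

theorem summable_surplus (c : ℝ) : Summable (G.surplus c) :=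
  (G.FG_hasSum.summable.mul_right _).sub
    (((G.FG_hasSum.summable.mul_right _).add (G.FB_hasSum.summable.mul_right _)).mul_left c)

theorem tsum_indicator_mass_pos {A : Set E} (hA : A.Nonempty) :
    0 < (∑' e, A.indicator G.FG e) * G.π0 + (∑' e, A.indicator G.FB e) * (1 - G.π0) := by
  obtain ⟨a, ha⟩ := hA
  have hg := (G.FG_hasSum.summable.indicator A).le_tsum a fun e _ =>
    Set.indicator_nonneg (fun e _ => G.FG_nonneg e) e
  have hb := (G.FB_hasSum.summable.indicator A).le_tsum a fun e _ =>
    Set.indicator_nonneg (fun e _ => G.FB_nonneg e) e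
  rw [Set.indicator_of_mem ha] at hg hb
  exact (G.mass_pos a).trans_le (add_le_add (mul_le_mul_of_nonneg_right hg G.π0_pos.le)
    (mul_le_mul_of_nonneg_right hb (sub_pos.2 G.π0_lt_one).le))

theorem tsum_indicator_surplus (c : ℝ) {A : Set E} (hA : A.Nonempty) :
    ∑' e, A.indicator (G.surplus c) e = (G.nu A - c) *
      ((∑' e, A.indicator G.FG e) * G.π0 + (∑' e, A.indicator G.FB e) * (1 - G.π0)) := by
  have hg := (G.FG_hasSum.summable.indicator A).hasSum.mul_right G.π0
  have hb := (G.FB_hasSum.summable.indicator A).hasSum.mul_right (1 - G.π0)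
  have hs := hg.sub ((hg.add hb).mul_left c)
  rw [sub_mul, nu_eq_indicator, div_mul_cancel₀ _ (G.tsum_indicator_mass_pos hA).ne',
    ← hs.tsum_eq]
  refine tsum_congr fun e => ?_
  by_cases he : e ∈ A <;> simp [he, surplus]

theorem nu_singleton_lt {c : ℝ} {e : E} (h : G.surplus c e < 0) : G.nu {e} < c := by
  have hm := G.mass_pos e
  rw [nu, tsum_singleton e G.FG, tsum_singleton e G.FB, div_lt_iff₀ hm]
  unfold surplus at h
  linarith

variable {G} {V : E → ℝ}

theorem Thm1Conds.nu_le (hV : G.Thm1Conds V) {x : ℝ} (hx : x ∈ Set.range V) {L : Set E}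
    (hL : G.IsLCS (V ⁻¹' {x}) L) : G.nu (V ⁻¹' {x}) ≤ G.nu L := by
  exact (G.φ_mono.le_iff_le (G.nu_mem_Icc _) (G.nu_mem_Icc _)).1
    ((hV.2.1 x hx).le.trans (hV.2.2 x hx L hL))

/-- Within a level set of `V`, the surplus of good evidence can be assigned to the shortfall of
bad evidence along the disclosure rule so that both are exhausted. -/
theorem Thm1Conds.exists_transport (hV : G.Thm1Conds V) {x : ℝ} (hx : x ∈ Set.range V) :
    ∃ T : E → E → ℝ, (∀ e m, 0 ≤ T e m) ∧ (∀ e m, ¬ G.r m e → T e m = 0) ∧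
      (∀ e, HasSum (T e)
        ((V ⁻¹' {x}).indicator (fun e => (G.surplus (G.nu (V ⁻¹' {x})) e)⁻) e)) ∧
      ∀ m, HasSum (fun e => T e m)
        ((V ⁻¹' {x}).indicator (fun e => (G.surplus (G.nu (V ⁻¹' {x})) e)⁺) m) := by
  set A : Set E := V ⁻¹' {x}
  set w : E → ℝ := G.surplus (G.nu A)
  set n : E → ℝ := A.indicator fun e => (w e)⁻ with hn
  set p : E → ℝ := A.indicator fun e => (w e)⁺ with hp
  have hn0 : ∀ e, 0 ≤ n e := Set.indicator_nonneg fun e _ => negPart_nonneg (w e)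
  have hp0 : ∀ e, 0 ≤ p e := Set.indicator_nonneg fun e _ => posPart_nonneg (w e)
  have hws : Summable w := G.summable_surplus _
  have hns : Summable n := (hws.abs.of_nonneg_of_le (fun e => negPart_nonneg (w e))
    fun e => sup_le (neg_le_abs _) (abs_nonneg _)).indicator A
  have hps : Summable p := (hws.abs.of_nonneg_of_le (fun e => posPart_nonneg (w e))
    fun e => sup_le (le_abs_self _) (abs_nonneg _)).indicator A
  have hsub : ∀ L : Set E, L ⊆ A → ∑' e, L.indicator w e =
      ∑' e, L.indicator p e - ∑' e, L.indicator n e := by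
    intro L hL
    rw [← (hps.indicator L).tsum_sub (hns.indicator L)]
    refine tsum_congr fun e => ?_
    by_cases he : e ∈ L
    · simp [he, hL he, hp, hn, posPart_sub_negPart]
    · simp [he]
  have hne : A.Nonempty := hx.imp fun e he => he
  refine exists_transport_of_hall (R := fun e m => G.r m e) hn0 hp0 hns hps ?_ fun S => ?_
  · have h := hsub A subset_rfl
    rw [G.tsum_indicator_surplus _ hne, sub_self, zero_mul] at h
    simp only [hp, hn, Set.indicator_indicator, Set.inter_self] at h ⊢
    linarith
  · let L : Set E := {m | m ∈ A ∧ ∃ e ∈ S, e ∈ A ∧ G.r m e}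
    have hSL : ∑' e, S.indicator n e ≤ ∑' e, L.indicator n e := by
      refine (hns.indicator S).tsum_le_tsum (fun e => ?_) (hns.indicator L)
      by_cases hS : e ∈ S
      · by_cases heA : e ∈ A
        · have : e ∈ L := ⟨heA, e, hS, heA, G.r_refl e⟩
          simp [hS, this]
        · rw [Set.indicator_of_mem hS, hn, Set.indicator_of_notMem heA]
          exact Set.indicator_nonneg (fun e _ => hn0 e) e
      · simpa [hS] using Set.indicator_nonneg (fun e _ => hn0 e) e
    have hLS : ∑' e, L.indicator p e ≤ ∑' m, {m | ∃ e ∈ S, G.r m e}.indicator p m := by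
      refine (hps.indicator L).tsum_le_tsum (fun e => ?_) (hps.indicator _)
      exact Set.indicator_le_indicator_of_subset
        (fun m hm => hm.2.imp fun e he => ⟨he.1, he.2.2⟩) hp0 e
    refine hSL.trans (le_trans ?_ hLS)
    rcases L.eq_empty_or_nonempty with hL | hL
    · simp [hL]
    · have hLCS : G.IsLCS A L := ⟨hL, fun m hm => hm.1, fun m hm m' hm' hr =>
        ⟨hm', hm.2.imp fun e he => ⟨he.1, he.2.1, G.r_trans hr he.2.2⟩⟩⟩
      have h := hsub L fun m hm => hm.1
      rw [G.tsum_indicator_surplus _ hL] at h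
      have := mul_nonneg (sub_nonneg.2 (hV.nu_le hx hLCS)) (G.tsum_indicator_mass_pos hL).le
      linarith

end DGame

/-- Theorem 1 (sufficiency; Lemma A.3): in any disclosure game, any function
satisfying the Theorem-1 conditions is the sender's value function of some
truth-leaning equilibrium. -/
theorem stmt_1 {E : Type u} [Countable E] (G : DGame E)
    (V : E → ℝ) (hV : G.Thm1Conds V) : ∃ Q : G.Eqm, G.IsValueFn Q V := by
  classical
  choose! T hT0 hTR hTrow hTcol using fun x (hx : x ∈ Set.range V) => hV.exists_transport hx
  let c : E → ℝ := fun e => G.nu (V ⁻¹' {V e})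
  let w : E → ℝ := fun e => G.surplus (c e) e
  have hφc : ∀ e, G.φ (c e) = V e := fun e => hV.2.1 (V e) ⟨e, rfl⟩
  have hrow : ∀ e, w e < 0 → HasSum (T (V e) e) (-w e) := fun e he => by
    have h := hTrow (V e) ⟨e, rfl⟩ e
    rwa [Set.indicator_of_mem (by simp), negPart_of_nonpos he.le] at h
  have hcol : ∀ m, 0 ≤ w m → HasSum (fun e => T (V m) e m) (w m) := fun m hm => by
    have h := hTcol (V m) ⟨m, rfl⟩ m
    rwa [Set.indicator_of_mem (by simp), posPart_of_nonneg hm] at h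
  have hpos : ∀ e m, 0 < T (V e) e m → V m = V e ∧ 0 < w m := by
    intro e m h
    have hle := le_hasSum (hTcol (V e) ⟨e, rfl⟩ m) e fun e' _ => hT0 (V e) ⟨e, rfl⟩ e' m
    have h' := h.trans_le hle
    by_cases hm : V m = V e
    · rw [Set.indicator_of_mem (by simpa using hm), ← hm, posPart_pos_iff] at h'
      exact ⟨hm, h'⟩
    · rw [Set.indicator_of_notMem (by simpa using hm)] at h'
      exact absurd h' (lt_irrefl _)
  have hzero : ∀ e m, V e ≠ V m ∨ 0 ≤ w e → T (V m) e m = 0 := by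
    intro e m h
    have hle := le_hasSum (hTrow (V m) ⟨m, rfl⟩ e) m fun m' _ => hT0 (V m) ⟨m, rfl⟩ e m'
    refine le_antisymm (hle.trans ?_) (hT0 (V m) ⟨m, rfl⟩ e m)
    by_cases hm : V e = V m
    · rw [Set.indicator_of_mem (by simpa using hm), ← hm,
        negPart_of_nonneg (h.resolve_left (not_not.2 hm))]
    · rw [Set.indicator_of_notMem (by simpa using hm)]
  let σ : E → E → ℝ := fun e m => if w e < 0 then T (V e) e m / (-w e) else if m = e then 1 else 0
  have hσ0 : ∀ e m, 0 ≤ σ e m := by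
    intro e m
    dsimp only [σ]
    split_ifs with h
    · exact div_nonneg (hT0 (V e) ⟨e, rfl⟩ e m) (by linarith)
    · exact zero_le_one
    · exact le_rfl
  have hσsum : ∀ e, HasSum (σ e) 1 := by
    intro e
    by_cases h : w e < 0
    · have := (hrow e h).div_const (-w e)
      rw [div_self (by linarith)] at this
      simpa only [σ, h, if_true] using this
    · simpa only [σ, h, if_false] using hasSum_ite_eq e (1 : ℝ)
  have hσpos : ∀ e m, 0 < σ e m → G.r m e ∧ V m = V e ∧ 0 ≤ w m := by
    intro e m h
    by_cases he : w e < 0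
    · simp only [σ, he, if_true] at h
      have hT : 0 < T (V e) e m := (div_pos_iff_of_pos_right (by linarith)).1 h
      obtain ⟨h1, h2⟩ := hpos e m hT
      exact ⟨not_not.1 fun hR => hT.ne' (hTR (V e) ⟨e, rfl⟩ e m hR), h1, h2.le⟩
    · simp only [σ, he, if_false] at h
      obtain rfl : m = e := by
        by_contra hne
        simp [hne] at h
      exact ⟨G.r_refl m, rfl, not_lt.1 he⟩
  have hσself : ∀ e, 0 ≤ w e → σ e e = 1 := fun e he => by simp [σ, not_lt.2 he]
  let μ : E → ℝ := fun m => if 0 ≤ w m then c m else G.nu {m}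
  have hact : ∀ m, 0 ≤ w m → G.φ (μ m) = V m := fun m hm => by simp only [μ, hm, if_true, hφc]
  have hactlt : ∀ m, w m < 0 → G.φ (μ m) < V m := fun m hm => by
    simp only [μ, not_le.2 hm, if_false]
    rw [← hφc m]
    exact G.φ_mono (G.nu_mem_Icc _) (G.nu_mem_Icc _) (G.nu_singleton_lt hm)
  have hactle : ∀ m, G.φ (μ m) ≤ V m := fun m =>
    (le_or_gt 0 (w m)).elim (fun h => (hact m h).le) fun h => (hactlt m h).le
  have hbayes : ∀ m, (∃ e, 0 < σ e m) →
      μ m = (∑' e : {e : E // G.r m e}, σ e.1 m * G.FG e.1 * G.π0) /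
        (∑' e : {e : E // G.r m e}, σ e.1 m * (G.FG e.1 * G.π0 + G.FB e.1 * (1 - G.π0))) := by
    rintro m ⟨e₀, he₀⟩
    have hm : 0 ≤ w m := (hσpos e₀ m he₀).2.2
    have hσR : ∀ e, σ e m ≠ 0 → G.r m e := fun e he => (hσpos e m ((hσ0 e m).lt_of_ne' he)).1
    have hσ1 : ∀ e, σ e m ≤ 1 := fun e => le_hasSum (hσsum e) m fun m' _ => hσ0 e m'
    have hnum : (∑' e : {e : E // G.r m e}, σ e.1 m * G.FG e.1 * G.π0) =
        ∑' e, σ e m * G.FG e * G.π0 :=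
      tsum_subtype_eq_of_support_subset (s := {e | G.r m e})
        (f := fun e => σ e m * G.FG e * G.π0) fun e he =>
          hσR e fun h => he (by simp [h])
    have hden : (∑' e : {e : E // G.r m e},
          σ e.1 m * (G.FG e.1 * G.π0 + G.FB e.1 * (1 - G.π0))) =
        ∑' e, σ e m * (G.FG e * G.π0 + G.FB e * (1 - G.π0)) :=
      tsum_subtype_eq_of_support_subset (s := {e | G.r m e})
        (f := fun e => σ e m * (G.FG e * G.π0 + G.FB e * (1 - G.π0))) fun e he =>
          hσR e fun h => he (by simp [h])
    have hsg : Summable fun e => σ e m * G.FG e * G.π0 :=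
      (G.FG_hasSum.summable.of_nonneg_of_le
        (fun e => mul_nonneg (hσ0 e m) (G.FG_nonneg e))
        fun e => mul_le_of_le_one_left (G.FG_nonneg e) (hσ1 e)).mul_right _
    have hsd : Summable fun e => σ e m * (G.FG e * G.π0 + G.FB e * (1 - G.π0)) :=
      ((G.FG_hasSum.summable.mul_right G.π0).add
        (G.FB_hasSum.summable.mul_right (1 - G.π0))).of_nonneg_of_le
        (fun e => mul_nonneg (hσ0 e m) (G.mass_pos e).le)
        fun e => mul_le_of_le_one_left (G.mass_pos e).le (hσ1 e)
    have hdpos : 0 < ∑' e, σ e m * (G.FG e * G.π0 + G.FB e * (1 - G.π0)) :=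
      hsd.tsum_pos (fun e => mul_nonneg (hσ0 e m) (G.mass_pos e).le) m
        (by rw [hσself m hm, one_mul]; exact G.mass_pos m)
    have hbal : HasSum (fun e => σ e m * G.surplus (c m) e) 0 := by
      have h := (hasSum_ite_eq m (w m)).sub (hcol m hm)
      rw [sub_self] at h
      refine (congrArg (HasSum · 0) (funext fun e => ?_)).mpr h
      by_cases hVe : V e = V m
      · have hce : G.surplus (c m) e = w e := by simp only [w, c, hVe]
        by_cases he : w e < 0
        · have hne : e ≠ m := by rintro rfl; exact hm.not_gt he
          rw [hce]
          simp only [σ, he, hne, if_true, if_false, hVe]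
          rw [div_neg, neg_mul, div_mul_cancel₀ _ he.ne, zero_sub]
        · rw [hzero e m (Or.inr (not_lt.1 he)), hce]
          by_cases hem : e = m
          · subst hem; simp [σ, he]
          · simp [σ, he, hem, Ne.symm hem]
      · have hne : e ≠ m := by rintro rfl; exact hVe rfl
        have : σ e m = 0 := by
          by_contra h0
          exact hVe (hσpos e m ((hσ0 e m).lt_of_ne' h0)).2.1.symm
        simp [this, hne, hzero e m (Or.inl hVe)]
    have heq := (hsg.hasSum.sub (hsd.hasSum.mul_left (c m))).unique
      ((congrArg (HasSum · 0) (funext fun e => by simp only [DGame.surplus]; ring)).mpr hbal)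
    rw [hnum, hden, eq_div_iff hdpos.ne']
    simp only [μ, hm, if_true]
    linarith
  refine ⟨{
    σ := σ
    act := fun m => G.φ (μ m)
    μ := μ
    σ_nonneg := hσ0
    σ_hasSum := hσsum
    feasible := fun e m h => (hσpos e m h).1
    μ_mem := fun m => ?_
    sender_opt := fun e m h m' hr => ?_
    receiver_opt := fun m => rfl
    bayes := hbayes
    truth_leaning := fun e h => ?_
    offpath := fun m h => ?_ }, fun e m h => ?_⟩
  · dsimp only [μ]
    split_ifs <;> exact G.nu_mem_Icc _
  · obtain ⟨-, hVm, hm⟩ := hσpos e m h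
    rw [hact m hm, hVm]
    exact (hactle m').trans (hV.1 m' e hr)
  · refine hσself e (not_lt.1 fun he => ?_)
    obtain ⟨m, hm⟩ : ∃ m, 0 < σ e m := by
      by_contra! hall
      have : σ e = 0 := funext fun m => le_antisymm (hall m) (hσ0 e m)
      have h1 := hσsum e
      rw [this] at h1
      exact zero_ne_one (hasSum_zero.unique h1)
    obtain ⟨hr, hVm, hwm⟩ := hσpos e m hm
    have := h m hr
    rw [hact m hwm, hVm] at this
    exact this.not_gt (hactlt e he)
  · have : ¬ 0 ≤ w m := fun hm => h ⟨m, by rw [hσself m hm]; exact one_pos⟩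
    simp only [μ, this, if_false]
  · obtain ⟨-, hVm, hm⟩ := hσpos e m h
    exact hVm.symm.trans (hact m hm).symm
end

section
/- Theorem 4 (existence): In any disclosure game, if every connected subset of E has finitely many minimal elements, then there exists an ordered partition of E satisfying the Corollary-2 conditions (equivalently, by Theorem 1 and Corollary 2, a truth-leaning equilibrium exists). -/
open scoped BigOperators

universe u

/-- An ordered partition of `E`: a partition into nonempty cells together with
a total order on the cells. -/
structure OPart (E : Type u) where
  cells : Set (Set E)
  cells_nonempty : ∀ A ∈ cells, A.Nonempty
  cover : ∀ e : E, ∃ A ∈ cells, e ∈ A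
  disj : ∀ A ∈ cells, ∀ B ∈ cells, A ≠ B → Disjoint A B
  le : Set E → Set E → Prop
  le_refl : ∀ A ∈ cells, le A A
  le_trans : ∀ A ∈ cells, ∀ B ∈ cells, ∀ C ∈ cells, le A B → le B C → le A C
  le_antisymm : ∀ A ∈ cells, ∀ B ∈ cells, le A B → le B A → A = B
  le_total : ∀ A ∈ cells, ∀ B ∈ cells, le A B ∨ le B A

/-- The Corollary-2 conditions on an ordered partition. -/
def Crl2Conds {E : Type u} (G : DGame E) (P : OPart E) : Prop :=
  (∀ A ∈ P.cells, ∀ B ∈ P.cells, P.le A B → A ≠ B → G.xi A < G.xi B) ∧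
  (∀ A ∈ P.cells, ∀ B ∈ P.cells, ∀ e₁ ∈ A, ∀ e₂ ∈ B, G.r e₁ e₂ → P.le A B) ∧
  (∀ A ∈ P.cells, ∀ L : Set E, G.IsLCS A L → G.xi A ≤ G.xi L)

/-- `A` is connected (with respect to the disclosure rule `r`): any two of its
elements are linked by a finite chain in `A` of comparable consecutive
elements. -/
def ConnectedIn {E : Type u} (r : E → E → Prop) (A : Set E) : Prop :=
  ∀ e ∈ A, ∀ e' ∈ A, ∃ (n : ℕ) (f : ℕ → E), f 0 = e ∧ f n = e' ∧
    (∀ k ≤ n, f k ∈ A) ∧ ∀ k < n, r (f k) (f (k + 1)) ∨ r (f (k + 1)) (f k)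

/-- The set of minimal elements of `A`. -/
def MinimalsIn {E : Type u} (r : E → E → Prop) (A : Set E) : Set E :=
  {e | e ∈ A ∧ ∀ e' ∈ A, r e' e → r e e'}

/-- Existence and variational inequality of the weighted isotonic regression of `p / w`
along a relation `r`. -/
theorem exists_isotonic_regression {E : Type u} (r : E → E → Prop) {w p : E → ℝ}
    (hw : ∀ e, 0 < w e) (hws : Summable w) (hp : ∀ e, 0 ≤ p e) (hpw : ∀ e, p e ≤ w e) :
    ∃ V : E → ℝ, (∀ a b, r a b → V a ≤ V b) ∧ Summable (fun e => p e - w e * V e) ∧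
      ∀ (h : E → ℝ) (δ : ℝ), 0 < δ → (∀ e, |h e| ≤ 1) →
        (∀ a b, r a b → V a + δ * h a ≤ V b + δ * h b) →
        ∑' e, (p e - w e * V e) * h e ≤ 0 := by
  have hs : ∀ e, 0 < √(w e) := fun e => Real.sqrt_pos.2 (hw e)
  have hss : ∀ e, √(w e) * √(w e) = w e := fun e => Real.mul_self_sqrt (hw e).le
  have mem : ∀ g : E → ℝ, (∀ e, |g e| ≤ 1) →
      Memℓp (E := fun _ : E => ℝ) (fun e => √(w e) * g e) 2 := by
    intro g hg
    refine memℓp_gen (hws.of_nonneg_of_le (fun e => by positivity) fun e => ?_)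
    have h1 : (g e) ^ 2 ≤ 1 := (sq_le_one_iff_abs_le_one _).2 (hg e)
    have h2 : ‖√(w e) * g e‖ ^ (2 : ENNReal).toReal = w e * g e ^ 2 := by
      rw [ENNReal.toReal_ofNat, Real.rpow_ofNat, Real.norm_eq_abs, sq_abs, mul_pow,
        Real.sq_sqrt (hw e).le]
    rw [h2]
    exact mul_le_of_le_one_right (hw e).le h1
  let K : Set (lp (fun _ : E => ℝ) 2) :=
    {u | ∀ a b, r a b → u a / √(w a) ≤ u b / √(w b)}
  have hcont : ∀ e, Continuous fun u : lp (fun _ : E => ℝ) 2 => u e := fun e =>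
    (continuous_apply e).comp (lp.uniformContinuous_coe (E := fun _ : E => ℝ) (p := 2)).continuous
  have hKc : IsClosed K := by
    have : K = ⋂ a, ⋂ b, ⋂ _ : r a b, {u | u a / √(w a) ≤ u b / √(w b)} := by
      ext u; simp [K]
    rw [this]
    exact isClosed_iInter fun a => isClosed_iInter fun b => isClosed_iInter fun _ =>
      isClosed_le ((hcont a).div_const _) ((hcont b).div_const _)
  have hKconv : Convex ℝ K := by
    intro u hu v hv s t hs0 ht0 _ a b hab
    have h1 := mul_le_mul_of_nonneg_left (hu a b hab) hs0
    have h2 := mul_le_mul_of_nonneg_left (hv a b hab) ht0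
    simp only [lp.coeFn_add, lp.coeFn_smul, Pi.add_apply, Pi.smul_apply, smul_eq_mul, add_div,
      mul_div_assoc]
    exact add_le_add h1 h2
  have hKne : K.Nonempty := ⟨0, fun a b _ => by simp⟩
  let y : lp (fun _ : E => ℝ) 2 := ⟨_, mem (fun e => p e / w e) fun e => by
    rw [abs_of_nonneg (div_nonneg (hp e) (hw e).le)]
    exact div_le_one_of_le₀ (hpw e) (hw e).le⟩
  have hy : ∀ e, y e = √(w e) * (p e / w e) := fun e => rfl
  obtain ⟨v, hvK, hv⟩ := exists_norm_eq_iInf_of_complete_convex hKne hKc.isComplete hKconv y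
  rw [norm_eq_iInf_iff_real_inner_le_zero hKconv hvK] at hv
  have key : ∀ e (x : ℝ), inner ℝ ((y - v) e) (√(w e) * x)
      = (p e - w e * (v e / √(w e))) * x := by
    intro e x
    rw [lp.coeFn_sub, Pi.sub_apply, hy]
    simp only [RCLike.inner_apply, conj_trivial]
    have h1 : √(w e) * (√(w e) * (p e / w e)) = p e := by
      rw [← mul_assoc, hss, mul_div_cancel₀ _ (hw e).ne']
    have h2 : w e * (v e / √(w e)) = √(w e) * v e := by
      rw [← hss e, mul_assoc, Real.sqrt_mul_self (hs e).le, mul_div_cancel₀ _ (hs e).ne']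
    rw [h2]
    linear_combination x * h1
  refine ⟨fun e => v e / √(w e), hvK, ?_, ?_⟩
  · have := lp.summable_inner (𝕜 := ℝ) (y - v) ⟨_, mem (fun _ => 1) (by simp)⟩
    exact this.congr fun e => (key e 1).trans (mul_one _)
  · intro h δ hδ hh hmono
    let H : lp (fun _ : E => ℝ) 2 := ⟨_, mem h hh⟩
    have hH : ∀ e, H e = √(w e) * h e := fun e => rfl
    have hk : v + δ • H ∈ K := by
      have h1 : ∀ e, (v + δ • H) e / √(w e) = v e / √(w e) + δ * h e := by
        intro e
        have := (hs e).ne'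
        simp only [lp.coeFn_add, lp.coeFn_smul, Pi.add_apply, Pi.smul_apply, smul_eq_mul, hH]
        field_simp
      intro a b hab
      rw [h1, h1]
      exact hmono a b hab
    have h2 := hv _ hk
    rw [add_sub_cancel_left, real_inner_smul_right, lp.inner_eq_tsum] at h2
    simp only [hH, key] at h2
    exact nonpos_of_mul_nonpos_right h2 hδ

/-- On each level set of the isotonic regression `V`, the weighted mean of `p / w` is the level,
and it is at least the level on every lower contour set. -/
theorem exists_isotonic_levels {E : Type u} (r : E → E → Prop) {w p : E → ℝ}
    (hw : ∀ e, 0 < w e) (hws : Summable w) (hp : ∀ e, 0 ≤ p e) (hpw : ∀ e, p e ≤ w e) :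
    ∃ V : E → ℝ, (∀ a b, r a b → V a ≤ V b) ∧
      (∀ t, ∑' e : V ⁻¹' {t}, p e = t * ∑' e : V ⁻¹' {t}, w e) ∧
      ∀ t, ∀ L ⊆ V ⁻¹' {t}, (∀ e ∈ L, ∀ e' ∈ V ⁻¹' {t}, r e' e → e' ∈ L) →
        t * ∑' e : L, w e ≤ ∑' e : L, p e := by
  obtain ⟨V, hV, hD, hvar⟩ := exists_isotonic_regression r hw hws hp hpw
  have hps : Summable p := hws.of_nonneg_of_le hp hpw
  have split : ∀ t, ∀ L ⊆ V ⁻¹' {t}, ∑' e, (p e - w e * V e) * L.indicator 1 e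
      = ∑' e : L, p e - t * ∑' e : L, w e := by
    intro t L hL
    have hsub : ∑' e : L, (p e - t * w e) = ∑' e : L, p e - ∑' e : L, t * w e :=
      (hps.subtype L).tsum_sub ((hws.subtype L).mul_left t)
    rw [← tsum_mul_left, ← hsub, tsum_subtype L (fun e => p e - t * w e)]
    refine tsum_congr fun e => ?_
    by_cases he : e ∈ L
    · have : V e = t := hL he
      simp [he, this, mul_comm]
    · simp [he]
  have lim : ∀ (g : ℕ → E → ℝ) (h : E → ℝ), (∀ n e, |g n e| ≤ 1) →
      (∀ (n : ℕ) a b, r a b →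
        V a + 1 / (n + 1 : ℝ) * g n a ≤ V b + 1 / (n + 1 : ℝ) * g n b) →
      (∀ e, ∀ᶠ n in Filter.atTop, g n e = h e) →
      ∑' e, (p e - w e * V e) * h e ≤ 0 := by
    intro g h hb hm hl
    have ht : Filter.Tendsto (fun n => ∑' e, (p e - w e * V e) * g n e) Filter.atTop
        (nhds (∑' e, (p e - w e * V e) * h e)) := by
      refine tendsto_tsum_of_dominated_convergence hD.abs (fun e => ?_)
        (Filter.Eventually.of_forall fun n e => ?_)
      · exact tendsto_const_nhds.congr' ((hl e).mono fun n hn => by simp only [hn])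
      · rw [Real.norm_eq_abs, abs_mul]
        exact mul_le_of_le_one_right (abs_nonneg _) (hb n e)
    exact le_of_tendsto' ht fun n => hvar _ _ (by positivity) (hb n) (hm n)
  -- A ramp descending from one to zero, of slope `-(n + 1)`.
  let ramp : ℕ → ℝ → ℝ := fun n s => max 0 (min 1 ((n + 1) * s))
  have ramp_nonneg : ∀ n s, 0 ≤ ramp n s := fun n s => le_max_left _ _
  have ramp_le_one : ∀ n s, ramp n s ≤ 1 := fun n s => max_le zero_le_one (min_le_left _ _)
  have ramp_lip : ∀ (n : ℕ) s s', s' ≤ s →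
      1 / (n + 1 : ℝ) * ramp n s ≤ (s - s') + 1 / (n + 1 : ℝ) * ramp n s' := by
    intro n s s' hs
    have hn : (0 : ℝ) < n + 1 := by positivity
    have h1 : ramp n s ≤ (n + 1) * (s - s') + ramp n s' := by
      have h0 : 0 ≤ (n + 1 : ℝ) * (s - s') := mul_nonneg hn.le (sub_nonneg.2 hs)
      simp only [ramp]
      rcases le_total ((n + 1 : ℝ) * s') 1 with h | h
      · rw [min_eq_right h]
        refine max_le (add_nonneg h0 (le_max_left _ _)) ((min_le_right _ _).trans ?_)
        linarith [le_max_right 0 ((n + 1 : ℝ) * s')]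
      · rw [min_eq_left h]
        refine (ramp_le_one n s).trans ?_
        linarith [le_max_right (0 : ℝ) 1]
    have h2 := mul_le_mul_of_nonneg_left h1 (by positivity : (0 : ℝ) ≤ 1 / (n + 1))
    rw [mul_add, ← mul_assoc, one_div_mul_cancel hn.ne', one_mul] at h2
    exact h2
  have ramp_nonpos : ∀ n s, s ≤ 0 → ramp n s = 0 := by
    intro n s hs
    have : (n + 1 : ℝ) * s ≤ 0 := mul_nonpos_of_nonneg_of_nonpos (by positivity) hs
    exact max_eq_left ((min_le_right _ _).trans this)
  have ramp_pos : ∀ s, 0 < s → ∀ᶠ n in Filter.atTop, ramp n s = 1 := by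
    intro s hs
    obtain ⟨N, hN⟩ := exists_nat_ge (1 / s)
    filter_upwards [Filter.eventually_ge_atTop N] with n hn
    have h1 : (N : ℝ) ≤ n := by exact_mod_cast hn
    have h2 : 1 ≤ (n + 1 : ℝ) * s := (div_le_iff₀ hs).1 (by linarith)
    simp only [ramp]
    rw [min_eq_left h2, max_eq_right zero_le_one]
  have lower : ∀ t, ∀ L ⊆ V ⁻¹' {t}, (∀ e ∈ L, ∀ e' ∈ V ⁻¹' {t}, r e' e → e' ∈ L) →
      t * ∑' e : L, w e ≤ ∑' e : L, p e := by
    intro t L hL hlow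
    have h1 := lim (fun n e => ramp n (t - V e) - (L ∪ {a | V a < t}).indicator 1 e)
      (fun e => -L.indicator 1 e) ?_ ?_ ?_
    · simp only [mul_neg, tsum_neg] at h1
      rw [split t L hL] at h1
      linarith
    · intro n e
      have := ramp_nonneg n (t - V e)
      have := ramp_le_one n (t - V e)
      rw [abs_le]
      by_cases he : e ∈ L ∪ {a | V a < t}
      · simp only [Set.indicator_of_mem he, Pi.one_apply]; constructor <;> linarith
      · simp only [Set.indicator_of_notMem he]; constructor <;> linarith
    · intro n a b hab
      have h2 := ramp_lip n (t - V a) (t - V b) (by linarith [hV a b hab])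
      have h3 : (L ∪ {a | V a < t}).indicator (1 : E → ℝ) b
          ≤ (L ∪ {a | V a < t}).indicator 1 a := by
        by_cases hb : b ∈ L ∪ {a | V a < t}
        · have ha : a ∈ L ∪ {a | V a < t} := by
            rcases hb with hb | hb
            · rcases (hV a b hab).lt_or_eq with hlt | heq
              · exact Or.inr (lt_of_lt_of_eq hlt (hL hb))
              · exact Or.inl (hlow b hb a (heq.trans (hL hb)) hab)
            · exact Or.inr ((hV a b hab).trans_lt hb)
          rw [Set.indicator_of_mem hb, Set.indicator_of_mem ha]
          rfl
        · rw [Set.indicator_of_notMem hb]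
          exact Set.indicator_nonneg (fun _ _ => zero_le_one) _
      have h4 := mul_le_mul_of_nonneg_left h3 (by positivity : (0 : ℝ) ≤ 1 / (n + 1))
      simp only [mul_sub]
      linarith
    · intro e
      rcases lt_or_ge (V e) t with hlt | hge
      · have hne : e ∉ L := fun he => hlt.ne (hL he)
        filter_upwards [ramp_pos _ (sub_pos.2 hlt)] with n hn
        simp [hn, hlt, hne]
      · refine Filter.Eventually.of_forall fun n => ?_
        have := ramp_nonpos n (t - V e) (by linarith)
        by_cases he : e ∈ L <;> simp [this, he, hge.not_gt]
  refine ⟨V, hV, fun t => le_antisymm ?_ ?_, lower⟩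
  · have h1 := lim (fun n e => {a | t ≤ V a}.indicator 1 e - ramp n (V e - t))
      (fun e => (V ⁻¹' {t}).indicator 1 e) ?_ ?_ ?_
    · rw [split t _ subset_rfl] at h1
      linarith
    · intro n e
      have := ramp_nonneg n (V e - t)
      have := ramp_le_one n (V e - t)
      rw [abs_le]
      by_cases he : e ∈ {a | t ≤ V a}
      · simp only [Set.indicator_of_mem he, Pi.one_apply]; constructor <;> linarith
      · simp only [Set.indicator_of_notMem he]; constructor <;> linarith
    · intro n a b hab
      have h2 := ramp_lip n (V b - t) (V a - t) (by linarith [hV a b hab])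
      have h3 : {a | t ≤ V a}.indicator (1 : E → ℝ) a ≤ {a | t ≤ V a}.indicator 1 b := by
        by_cases ha : a ∈ {a | t ≤ V a}
        · have hb : b ∈ {a | t ≤ V a} := le_trans ha (hV a b hab)
          rw [Set.indicator_of_mem hb, Set.indicator_of_mem ha]
          rfl
        · rw [Set.indicator_of_notMem ha]
          exact Set.indicator_nonneg (fun _ _ => zero_le_one) _
      have h4 := mul_le_mul_of_nonneg_left h3 (by positivity : (0 : ℝ) ≤ 1 / (n + 1))
      simp only [mul_sub]
      linarith
    · intro e
      rcases lt_trichotomy (V e) t with hlt | heq | hgt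
      · refine Filter.Eventually.of_forall fun n => ?_
        simp [ramp_nonpos n (V e - t) (by linarith), hlt.not_ge, hlt.ne]
      · refine Filter.Eventually.of_forall fun n => ?_
        simp [ramp_nonpos n 0 le_rfl, heq]
      · filter_upwards [ramp_pos _ (sub_pos.2 hgt)] with n hn
        simp [hn, hgt.le, hgt.ne']
  · exact lower t _ subset_rfl fun _ _ e' he' _ => he'

/-- The level sets of a function, ordered by their levels. -/
def OPart.ofLevels {E : Type u} (V : E → ℝ) : OPart E where
  cells := Set.range fun e => V ⁻¹' {V e}
  cells_nonempty := by rintro _ ⟨e, rfl⟩; exact ⟨e, rfl⟩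
  cover e := ⟨_, ⟨e, rfl⟩, rfl⟩
  disj := by
    rintro _ ⟨a, rfl⟩ _ ⟨b, rfl⟩ hab
    refine Set.disjoint_left.2 fun e (ha : V e = V a) (hb : V e = V b) => hab ?_
    simp only [← ha, ← hb]
  le A B := ∀ a ∈ A, ∀ b ∈ B, V a ≤ V b
  le_refl := by
    rintro _ ⟨e, rfl⟩ a (ha : V a = V e) b (hb : V b = V e)
    exact (ha.trans hb.symm).le
  le_trans := by
    rintro A - _ ⟨e, rfl⟩ C - hAB hBC a ha c hc
    exact (hAB a ha e rfl).trans (hBC e rfl c hc)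
  le_antisymm := by
    rintro _ ⟨a, rfl⟩ _ ⟨b, rfl⟩ hab hba
    have : V a = V b := (hab a rfl b rfl).antisymm (hba b rfl a rfl)
    simp only [this]
  le_total := by
    rintro _ ⟨a, rfl⟩ _ ⟨b, rfl⟩
    refine (_root_.le_total (V a) (V b)).imp ?_ ?_
    · rintro hab x (hx : V x = V a) z (hz : V z = V b)
      rwa [hx, hz]
    · rintro hab x (hx : V x = V b) z (hz : V z = V a)
      rwa [hx, hz]

/-- Theorem 4 (existence): if every connected subset of `E` has finitely many
minimal elements, then an ordered partition satisfying the Corollary-2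
conditions (equivalently, a truth-leaning equilibrium) exists. -/
theorem stmt_7 {E : Type u} [Countable E] (G : DGame E)
    (h : ∀ A : Set E, ConnectedIn G.r A → (MinimalsIn G.r A).Finite) :
    ∃ P : OPart E, Crl2Conds G P := by
  have hπ : 0 < 1 - G.π0 := sub_pos.2 G.π0_lt_one
  set p : E → ℝ := fun e => G.FG e * G.π0 with hp_def
  set w : E → ℝ := fun e => G.FG e * G.π0 + G.FB e * (1 - G.π0)
  have hp0 : ∀ e, 0 ≤ p e := fun e => mul_nonneg (G.FG_nonneg e) G.π0_pos.le
  have hq0 : ∀ e, 0 ≤ G.FB e * (1 - G.π0) := fun e => mul_nonneg (G.FB_nonneg e) hπ.le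
  have hpw : ∀ e, p e ≤ w e := fun e => le_add_of_nonneg_right (hq0 e)
  have hw : ∀ e, 0 < w e := by
    intro e
    rcases (G.FG_nonneg e).lt_or_eq with hG | hG
    · exact add_pos_of_pos_of_nonneg (mul_pos hG G.π0_pos) (hq0 e)
    · have hB : 0 < G.FB e := by have := G.FGB_pos e; rwa [← hG, zero_add] at this
      exact add_pos_of_nonneg_of_pos (hp0 e) (mul_pos hB hπ)
  have hps : Summable p := G.FG_hasSum.summable.mul_right _
  have hqs : Summable fun e => G.FB e * (1 - G.π0) := G.FB_hasSum.summable.mul_right _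
  have hws : Summable w := hps.add hqs
  have hnu : ∀ A : Set E, G.nu A = (∑' e : A, p e) / ∑' e : A, w e := by
    intro A
    have hsplit : ∑' e : A, w e = ∑' e : A, p e + ∑' e : A, G.FB e * (1 - G.π0) :=
      (hps.subtype A).tsum_add (hqs.subtype A)
    rw [hsplit, DGame.nu, hp_def, tsum_mul_right, tsum_mul_right]
  have hwA : ∀ A : Set E, A.Nonempty → 0 < ∑' e : A, w e := fun A ⟨a, ha⟩ =>
    (hws.subtype A).tsum_pos (fun e => (hw e.1).le) ⟨a, ha⟩ (hw a)
  have hnu_mem : ∀ A : Set E, G.nu A ∈ Set.Icc (0 : ℝ) 1 := by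
    intro A
    rw [hnu]
    exact ⟨div_nonneg (tsum_nonneg fun e => hp0 e) (tsum_nonneg fun e => (hw e).le),
      div_le_one_of_le₀ ((hps.subtype A).tsum_le_tsum (fun e => hpw e) (hws.subtype A))
        (tsum_nonneg fun e => (hw e).le)⟩
  obtain ⟨V, hV, hlevel, hlower⟩ := exists_isotonic_levels G.r hw hws hp0 hpw
  have hnuV : ∀ e, G.nu (V ⁻¹' {V e}) = V e := by
    intro e
    rw [hnu, hlevel, mul_div_cancel_right₀ _ (hwA (V ⁻¹' {V e}) ⟨e, rfl⟩).ne']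
  refine ⟨OPart.ofLevels V, ?_, ?_, ?_⟩
  · rintro _ ⟨a, rfl⟩ _ ⟨b, rfl⟩ hle hne
    refine G.φ_mono (hnu_mem _) (hnu_mem _) ?_
    simp only [hnuV]
    refine lt_of_le_of_ne (hle a rfl b rfl) fun heq => hne ?_
    simp only [heq]
  · rintro _ ⟨a, rfl⟩ _ ⟨b, rfl⟩ e₁ (h₁ : V e₁ = V a) e₂ (h₂ : V e₂ = V b) hr
      x (hx : V x = V a) z (hz : V z = V b)
    rw [hx, hz, ← h₁, ← h₂]
    exact hV _ _ hr
  · rintro _ ⟨a, rfl⟩ L ⟨hne, hsub, hL⟩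
    refine G.φ_mono.monotoneOn (hnu_mem _) (hnu_mem _) ?_
    simp only [hnuV]
    rw [hnu, le_div_iff₀ (hwA L hne)]
    exact hlower _ L hsub hL
end

section
/- Proposition 4: In the left-censored disclosure model, the function V satisfies the Theorem-1 conditions (with ξ = ν since φ is the identity): (1) V is non-decreasing with respect to the suffix order ≼; (2) ν(V⁻¹(x)) = x for every x in the range of V; (3) ν(L) ≥ x for every x in the range of V and every lower contour set L in V⁻¹(x). Consequently, a truth-leaning equilibrium exists and V is the sender's value function in every truth-leaning equilibrium. -/
open scoped BigOperators

namespace LeftCensored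

/-- Evidence: a finite sequence of binary signals; `true` stands for a high
return (`g`) and `false` for a low return (`b`). A sequence is a list whose
suffixes are the most recent signals. -/
abbrev Ev := List Bool

/-- `G(e)`: the number of `g`'s in `e`. -/
def Gc (e : Ev) : ℕ := e.count true

/-- `B(e)`: the number of `b`'s in `e`. -/
def Bc (e : Ev) : ℕ := e.count false

/-- `D(e) = G(e) − B(e)`. -/
def D (e : Ev) : ℤ := (Gc e : ℤ) - (Bc e : ℤ)

/-- `N(e) = max_{0 ≤ k ≤ L(e)} D(e|_k)`, the maximum of `D` over all suffixes
(truncations from the left) of `e`; since the empty suffix gives `D = 0`, this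
equals the fold of `max` over the suffixes starting from `0`. -/
def N (e : Ev) : ℤ := (e.tails.map D).foldr max 0

/-- The evidence distribution in the good state. -/
noncomputable def FG (p q : ℝ) (e : Ev) : ℝ := (1 - p - q) * p ^ Gc e * q ^ Bc e

/-- The evidence distribution in the bad state. -/
noncomputable def FB (p q : ℝ) (e : Ev) : ℝ := (1 - p - q) * p ^ Bc e * q ^ Gc e

/-- Posterior belief `ν(A)` that the state is good given evidence in `A`. -/
noncomputable def nu (p q π0 : ℝ) (A : Set Ev) : ℝ :=
  ((∑' e : A, FG p q e) * π0) /
    ((∑' e : A, FG p q e) * π0 + (∑' e : A, FB p q e) * (1 - π0))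

/-- `α = (1 − √(1 − 4pq))/2`. -/
noncomputable def alpha (p q : ℝ) : ℝ := (1 - Real.sqrt (1 - 4 * p * q)) / 2

/-- The sender's equilibrium value function (Proposition 4). -/
noncomputable def V (p q π0 : ℝ) (e : Ev) : ℝ :=
  1 / (1 + ((1 - π0) / π0) * ((p - alpha p q) / (q - alpha p q)) * (q / p) ^ (N e + 1))

/-- `L` is a (nonempty) lower contour set in `A` with respect to the suffix
(left-censoring) order. -/
def IsLCS (A L : Set Ev) : Prop :=
  L.Nonempty ∧ L ⊆ A ∧ ∀ e ∈ L, ∀ e' ∈ A, e' <:+ e → e' ∈ L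

/-- A truth-leaning equilibrium of the left-censored disclosure game (the
receiver's response `φ` is the identity). -/
structure Eqm (p q π0 : ℝ) where
  σ : Ev → Ev → ℝ
  act : Ev → ℝ
  μ : Ev → ℝ
  σ_nonneg : ∀ e m, 0 ≤ σ e m
  σ_hasSum : ∀ e, HasSum (σ e) 1
  feasible : ∀ e m, 0 < σ e m → m <:+ e
  μ_mem : ∀ m, μ m ∈ Set.Icc (0 : ℝ) 1
  sender_opt : ∀ e m, 0 < σ e m → ∀ m', m' <:+ e → act m' ≤ act m
  receiver_opt : ∀ m, act m = μ m
  bayes : ∀ m, (∃ e, 0 < σ e m) →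
    μ m = (∑' e : {e : Ev // m <:+ e}, σ e.1 m * FG p q e.1 * π0) /
      (∑' e : {e : Ev // m <:+ e}, σ e.1 m * (FG p q e.1 * π0 + FB p q e.1 * (1 - π0)))
  truth_leaning : ∀ e, (∀ m, m <:+ e → act m ≤ act e) → σ e e = 1
  offpath : ∀ m, (¬ ∃ e, 0 < σ e m) → μ m = nu p q π0 {m}

end LeftCensored

namespace LeftCensored

/-! ### Sums over binary sequences -/

theorem hasSum_listBool {Φ : Ev → ℝ} {s t : ℝ} (ht : HasSum (fun l => Φ (true :: l)) s)
    (hf : HasSum (fun l => Φ (false :: l)) t) : HasSum Φ (Φ [] + s + t) := by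
  have inj (b : Bool) : Function.Injective (fun l : Ev => b :: l) := List.cons_injective
  have e1 : HasSum (fun e : ({[]} : Set Ev) => Φ e) (Φ []) := by
    simpa using hasSum_unique (fun e : ({[]} : Set Ev) => Φ e)
  have e2 := (inj true).hasSum_range_iff.2 ht
  have e3 := (inj false).hasSum_range_iff.2 hf
  have h12 := HasSum.add_disjoint (f := Φ)
    (s := ({[]} : Set Ev)) (t := Set.range (fun l : Ev => true :: l)) (by simp) e1 e2
  refine HasSum.add_isCompl ⟨?_, ?_⟩ h12 e3
  · rw [Set.disjoint_left]
    rintro e (rfl | ⟨l, rfl⟩) <;> simp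
  · rw [codisjoint_iff]
    ext e
    rcases e with _ | ⟨_ | _, l⟩ <;> simp

theorem hasSum_telescope {Φ : Ev → ℝ} (h : Summable Φ) :
    HasSum (fun e => Φ e - Φ (true :: e) - Φ (false :: e)) (Φ []) := by
  have ht := (h.comp_injective (List.cons_injective (a := true))).hasSum
  have hf := (h.comp_injective (List.cons_injective (a := false))).hasSum
  have hsum := ((hasSum_listBool ht hf).sub ht).sub hf
  rwa [add_sub_right_comm, add_sub_cancel_right, add_sub_cancel_right] at hsum

/-- All sequences of length at most `n`. -/
def listsUpTo : ℕ → Finset Ev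
  | 0 => {[]}
  | n + 1 => insert [] ((listsUpTo n).image (List.cons true) ∪ (listsUpTo n).image (List.cons false))

theorem mem_listsUpTo {n : ℕ} {e : Ev} (h : e.length ≤ n) : e ∈ listsUpTo n := by
  induction n generalizing e with
  | zero => simpa [listsUpTo] using h
  | succ n ih =>
    rcases e with _ | ⟨_ | _, l⟩
    · simp [listsUpTo]
    · simpa [listsUpTo] using ih (by simpa using h)
    · simpa [listsUpTo] using ih (by simpa using h)

@[simp] theorem Gc_nil : Gc [] = 0 := rfl
@[simp] theorem Bc_nil : Bc [] = 0 := rfl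
@[simp] theorem Gc_true (l : Ev) : Gc (true :: l) = Gc l + 1 := by simp [Gc]
@[simp] theorem Gc_false (l : Ev) : Gc (false :: l) = Gc l := by simp [Gc]
@[simp] theorem Bc_true (l : Ev) : Bc (true :: l) = Bc l := by simp [Bc]
@[simp] theorem Bc_false (l : Ev) : Bc (false :: l) = Bc l + 1 := by simp [Bc]

theorem summable_pow_count {p q : ℝ} (hp : 0 ≤ p) (hq : 0 ≤ q) (hpq : p + q < 1) :
    Summable (fun e : Ev => p ^ Gc e * q ^ Bc e) := by
  have key (n : ℕ) : ∑ e ∈ listsUpTo n, p ^ Gc e * q ^ Bc e ≤ 1 / (1 - p - q) := by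
    have hc : 1 / (1 - p - q) = 1 + (p + q) * (1 / (1 - p - q)) := by
      have : 1 - p - q ≠ 0 := by linarith
      field_simp
      ring
    induction n with
    | zero =>
      have : 0 ≤ (p + q) * (1 / (1 - p - q)) := by
        have : 0 < 1 - p - q := by linarith
        positivity
      simp only [listsUpTo, Finset.sum_singleton, Gc_nil, Bc_nil, pow_zero]
      linarith
    | succ n ih =>
      have hd : Disjoint ((listsUpTo n).image (List.cons true))
          ((listsUpTo n).image (List.cons false)) := by
        rw [Finset.disjoint_left]
        simp
      rw [listsUpTo, Finset.sum_insert (by simp), Finset.sum_union hd,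
        Finset.sum_image (by simp), Finset.sum_image (by simp)]
      have e1 : ∑ e ∈ listsUpTo n, p ^ Gc (true :: e) * q ^ Bc (true :: e) =
          p * ∑ e ∈ listsUpTo n, p ^ Gc e * q ^ Bc e := by
        rw [Finset.mul_sum]
        exact Finset.sum_congr rfl fun e _ => by simp [pow_succ]; ring
      have e2 : ∑ e ∈ listsUpTo n, p ^ Gc (false :: e) * q ^ Bc (false :: e) =
          q * ∑ e ∈ listsUpTo n, p ^ Gc e * q ^ Bc e := by
        rw [Finset.mul_sum]
        exact Finset.sum_congr rfl fun e _ => by simp [pow_succ]; ring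
      rw [e1, e2, hc]
      have := mul_le_mul_of_nonneg_left ih (add_nonneg hp hq)
      simp only [Gc_nil, Bc_nil, pow_zero]
      linarith
  refine summable_of_sum_le (c := 1 / (1 - p - q)) (fun e => by positivity) fun u => ?_
  refine le_trans (Finset.sum_le_sum_of_subset_of_nonneg (t := listsUpTo (u.sup List.length))
    (fun e he => mem_listsUpTo (Finset.le_sup (f := List.length) he)) fun e _ _ => by positivity)
    (key _)

/-! ### The maximal suffix difference -/

@[simp] theorem N_nil : N [] = 0 := rfl

theorem N_cons (x : Bool) (l : Ev) : N (x :: l) = max (D (x :: l)) (N l) := by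
  simp [N]

theorem D_le_N (e : Ev) : D e ≤ N e := by
  cases e with
  | nil => simp [D]
  | cons x l => rw [N_cons]; exact le_max_left _ _

theorem N_mono {m e : Ev} (h : m <:+ e) : N m ≤ N e := by
  obtain ⟨w, rfl⟩ := h
  induction w with
  | nil => simp
  | cons x w ih => rw [List.cons_append, N_cons]; exact ih.trans (le_max_right _ _)

/-- The drawdown `N(e) − D(e)`. -/
def drawdown (e : Ev) : ℕ := (N e - D e).toNat

theorem N_add_Bc (e : Ev) : N e + Bc e = drawdown e + Gc e := by
  have := D_le_N e
  simp only [drawdown]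
  rw [Int.toNat_of_nonneg (by omega), D]
  ring

theorem N_false (l : Ev) : N (false :: l) = N l := by
  have := D_le_N l
  rw [N_cons, max_eq_right]
  simp [D] at *
  omega

theorem drawdown_nil : drawdown [] = 0 := rfl

theorem drawdown_false (l : Ev) : drawdown (false :: l) = drawdown l + 1 := by
  have h := N_add_Bc l
  have h' := N_add_Bc (false :: l)
  rw [N_false] at h'
  simp at h'
  omega

theorem N_true_of_pos {l : Ev} (h : drawdown l ≠ 0) : N (true :: l) = N l := by
  have := N_add_Bc l
  rw [N_cons, max_eq_right]
  simp [D] at *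
  omega

theorem drawdown_true (l : Ev) : drawdown (true :: l) = drawdown l - 1 := by
  have h1 := N_add_Bc l
  have h2 := N_add_Bc (true :: l)
  have h3 : N (true :: l) = max (D (true :: l)) (N l) := N_cons _ _
  simp [D] at *
  omega

/-! ### The belief implied by the value function -/

/-- The standing assumptions on the parameters. -/
structure Admissible (p q π0 : ℝ) : Prop where
  q_pos : 0 < q
  q_lt_p : q < p
  add_lt_one : p + q < 1
  prior_pos : 0 < π0
  prior_lt_one : π0 < 1

namespace Admissible

variable {p q π0 : ℝ} (h : Admissible p q π0)
include h

theorem p_pos : 0 < p := h.q_pos.trans h.q_lt_p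

theorem disc_pos : 0 < 1 - 4 * p * q := by
  have := h.add_lt_one
  have := h.p_pos
  have := h.q_pos
  nlinarith [sq_nonneg (p - q)]

theorem alpha_sq : alpha p q = p * q + alpha p q ^ 2 := by
  have := Real.sq_sqrt h.disc_pos.le
  unfold alpha
  linarith [this]

theorem alpha_pos : 0 < alpha p q := by
  have : Real.sqrt (1 - 4 * p * q) < 1 := by
    rw [Real.sqrt_lt' one_pos]
    have := mul_pos h.p_pos h.q_pos
    linarith
  unfold alpha
  linarith

theorem alpha_lt_q : alpha p q < q := by
  have h1 := h.q_lt_p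
  have h2 := h.add_lt_one
  have h3 := h.q_pos
  have : 1 - 2 * q < Real.sqrt (1 - 4 * p * q) := by
    apply Real.lt_sqrt_of_sq_lt
    nlinarith
  unfold alpha
  linarith

theorem alpha_lt_p : alpha p q < p := h.alpha_lt_q.trans h.q_lt_p

end Admissible

/-- The relative excess of the good state over the bad state, for a walk held below its maximum
with `j` steps to spare. -/
noncomputable def excess (p q : ℝ) (j : ℕ) : ℝ :=
  (p - alpha p q) * (q ^ j - alpha p q ^ j) - (q - alpha p q) * (p ^ j - alpha p q ^ j)

theorem excess_zero (p q : ℝ) : excess p q 0 = 0 := by simp [excess]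

theorem excess_one (p q : ℝ) : excess p q 1 = 0 := by simp [excess]; ring

namespace Admissible

variable {p q π0 : ℝ} (h : Admissible p q π0)
include h

theorem excess_rec (j : ℕ) : excess p q (j + 1) =
    (1 - p - q) * ((p - alpha p q) * q ^ (j + 1) - (q - alpha p q) * p ^ (j + 1)) +
      p * q * excess p q j + excess p q (j + 2) := by
  have ha : alpha p q ^ (j + 1) = p * q * alpha p q ^ j + alpha p q ^ (j + 2) := by
    have := congrArg (fun x => alpha p q ^ j * x) h.alpha_sq
    linear_combination this
  unfold excess
  linear_combination ((q - alpha p q) - (p - alpha p q)) * ha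

theorem excess_nonpos (j : ℕ) : excess p q j ≤ 0 := by
  have hs : ∑ i ∈ Finset.range j, q ^ i * alpha p q ^ (j - 1 - i) ≤
      ∑ i ∈ Finset.range j, p ^ i * alpha p q ^ (j - 1 - i) := by
    have := h.alpha_pos
    have := h.q_pos
    have := h.q_lt_p
    gcongr
  have e1 := (Commute.all q (alpha p q)).geom_sum₂_mul j
  have e2 := (Commute.all p (alpha p q)).geom_sum₂_mul j
  have := mul_le_mul_of_nonneg_left hs
    (mul_pos (sub_pos.2 h.alpha_lt_p) (sub_pos.2 h.alpha_lt_q)).le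
  rw [excess, ← e1, ← e2]
  linarith

theorem abs_excess_le (j : ℕ) :
    |excess p q j| ≤ (p - alpha p q) * q ^ j + (q - alpha p q) * p ^ j := by
  have h1 := h.alpha_pos
  have h2 := sub_pos.2 h.alpha_lt_p
  have h3 := sub_pos.2 h.alpha_lt_q
  have h4 : alpha p q ^ j ≤ q ^ j := by have := h.alpha_lt_q; gcongr
  have h5 : alpha p q ^ j ≤ p ^ j := by have := h.alpha_lt_p; gcongr
  have h6 : 0 ≤ alpha p q ^ j := by positivity
  rw [abs_le]
  unfold excess
  have h7 : 0 < p := h.p_pos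
  have h8 : 0 < q := h.q_pos
  have i1 := mul_le_mul_of_nonneg_left h4 h2.le
  have i2 := mul_le_mul_of_nonneg_left h5 h3.le
  have i3 := mul_nonneg h2.le h6
  have i4 := mul_nonneg h3.le h6
  have i5 : 0 ≤ (p - alpha p q) * q ^ j := by positivity
  have i6 : 0 ≤ (q - alpha p q) * p ^ j := by positivity
  constructor <;> linarith

theorem ratio_pos : 0 < (p - alpha p q) / (q - alpha p q) :=
  div_pos (sub_pos.2 h.alpha_lt_p) (sub_pos.2 h.alpha_lt_q)

theorem odds_pos (n : ℤ) :
    0 < ((1 - π0) / π0) * ((p - alpha p q) / (q - alpha p q)) * (q / p) ^ n := by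
  have := h.ratio_pos
  have := h.p_pos
  have := h.q_pos
  have := h.prior_pos
  have := sub_pos.2 h.prior_lt_one
  positivity

theorem V_pos (e : Ev) : 0 < V p q π0 e := by
  have := h.odds_pos (N e + 1)
  unfold V
  positivity

theorem V_lt_one (e : Ev) : V p q π0 e < 1 := by
  have := h.odds_pos (N e + 1)
  unfold V
  rw [div_lt_one (by positivity)]
  linarith

theorem V_mono {m e : Ev} (hme : m <:+ e) : V p q π0 m ≤ V p q π0 e := by
  have hp := h.odds_pos (N e + 1)
  have hr := h.odds_pos 0
  simp only [zpow_zero, mul_one] at hr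
  have hpow : (q / p) ^ (N e + 1) ≤ (q / p) ^ (N m + 1) :=
    zpow_le_zpow_right_of_le_one₀ (div_pos h.q_pos h.p_pos)
      ((div_le_one h.p_pos).2 h.q_lt_p.le) (by have := N_mono hme; omega)
  unfold V
  gcongr

theorem V_odds (e : Ev) : π0 * (1 - V p q π0 e) =
    V p q π0 e * (1 - π0) * ((p - alpha p q) / (q - alpha p q)) * (q / p) ^ (N e + 1) := by
  have hp := h.odds_pos (N e + 1)
  have h0 := h.prior_pos.ne'
  unfold V
  generalize (p - alpha p q) / (q - alpha p q) = c at *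
  generalize (q / p) ^ (N e + 1) = r at *
  have : 1 + (1 - π0) / π0 * c * r ≠ 0 := by positivity
  rw [one_sub_div this]
  field_simp
  ring

theorem FG_pos (e : Ev) : 0 < FG p q e := by
  have : 0 < 1 - p - q := by linarith [h.add_lt_one]
  have := h.p_pos
  have := h.q_pos
  unfold FG
  positivity

theorem FB_pos (e : Ev) : 0 < FB p q e := by
  have : 0 < 1 - p - q := by linarith [h.add_lt_one]
  have := h.p_pos
  have := h.q_pos
  unfold FB
  positivity

theorem summable_FG : Summable (FG p q) := by
  have := (summable_pow_count h.p_pos.le h.q_pos.le h.add_lt_one).mul_left (1 - p - q)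
  refine this.congr fun e => ?_
  rw [FG]
  ring

theorem summable_FB : Summable (FB p q) := by
  have := (summable_pow_count h.q_pos.le h.p_pos.le
    (by linarith [h.add_lt_one])).mul_left (1 - p - q)
  refine this.congr fun e => ?_
  rw [FB]
  ring

end Admissible

/-- The normalisation that makes the surplus of `e` a multiple of an excess. -/
noncomputable def scale (p q π0 : ℝ) (e : Ev) : ℝ :=
  π0 * (1 - V p q π0 e) * p ^ Gc e * q ^ Bc e / ((p - alpha p q) * q ^ (drawdown e + 1))

/-- The belief mass of `e` in excess of the belief `x`. -/
noncomputable def surplus (p q π0 x : ℝ) (e : Ev) : ℝ :=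
  FG p q e * π0 * (1 - x) - FB p q e * (1 - π0) * x

/-- The total surplus of the sequences with suffix `e` and the same value as `e`. -/
noncomputable def treeSurplus (p q π0 : ℝ) (e : Ev) : ℝ :=
  scale p q π0 e * excess p q (drawdown e + 1)

theorem V_congr {p q π0 : ℝ} {e e' : Ev} (hN : N e = N e') : V p q π0 e = V p q π0 e' := by
  rw [V, V, hN]

theorem treeSurplus_eq_zero {p q π0 : ℝ} {e : Ev} (he : drawdown e = 0) :
    treeSurplus p q π0 e = 0 := by
  rw [treeSurplus, he, zero_add, excess_one, mul_zero]

theorem treeSurplus_nil (p q π0 : ℝ) : treeSurplus p q π0 [] = 0 :=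
  treeSurplus_eq_zero drawdown_nil

theorem V_cons_of_treeSurplus_ne_zero {p q π0 : ℝ} {x : Bool} {l : Ev}
    (he : treeSurplus p q π0 (x :: l) ≠ 0) : V p q π0 (x :: l) = V p q π0 l := by
  cases x with
  | false => exact V_congr (N_false l)
  | true =>
    refine V_congr (N_true_of_pos fun hl => he (treeSurplus_eq_zero ?_))
    rw [drawdown_true, hl]

namespace Admissible

variable {p q π0 : ℝ} (h : Admissible p q π0)
include h

theorem scale_pos (e : Ev) : 0 < scale p q π0 e := by
  have := h.prior_pos
  have := sub_pos.2 (h.V_lt_one e)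
  have := h.p_pos
  have := h.q_pos
  have := sub_pos.2 h.alpha_lt_p
  unfold scale
  positivity

theorem good_eq_scale (e : Ev) : FG p q e * π0 * (1 - V p q π0 e) =
    (1 - p - q) * scale p q π0 e * ((p - alpha p q) * q ^ (drawdown e + 1)) := by
  have := h.q_pos.ne'
  have := (sub_pos.2 h.alpha_lt_p).ne'
  unfold FG scale
  field_simp

theorem bad_eq_scale (e : Ev) : FB p q e * (1 - π0) * V p q π0 e =
    (1 - p - q) * scale p q π0 e * ((q - alpha p q) * p ^ (drawdown e + 1)) := by
  have hq := h.q_pos.ne'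
  have hp := h.p_pos.ne'
  have ha := (sub_pos.2 h.alpha_lt_p).ne'
  have hb := (sub_pos.2 h.alpha_lt_q).ne'
  have hN := N_add_Bc e
  unfold FB scale
  rw [h.V_odds]
  obtain ⟨n, hn⟩ := Int.eq_ofNat_of_zero_le
    (show 0 ≤ N e from N_mono (m := []) (List.nil_suffix))
  rw [hn] at hN ⊢
  have hN' : n + Bc e = drawdown e + Gc e := by exact_mod_cast hN
  have hz : (q / p) ^ ((n : ℤ) + 1) = q ^ (n + 1) / p ^ (n + 1) := by
    rw [← div_pow]
    exact_mod_cast zpow_natCast (q / p) (n + 1)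
  have hp' : p ^ Bc e * p ^ (n + 1) = p ^ Gc e * p ^ (drawdown e + 1) := by
    rw [← pow_add, ← pow_add]
    congr 1
    omega
  have hq' : q ^ Gc e * q ^ (drawdown e + 1) = q ^ (n + 1) * q ^ Bc e := by
    rw [← pow_add, ← pow_add]
    congr 1
    omega
  rw [hz]
  generalize V p q π0 e = v
  generalize alpha p q = a at *
  generalize q ^ (drawdown e + 1) = Q1 at *
  generalize p ^ (drawdown e + 1) = P1 at *
  have hP : p ^ (n + 1) ≠ 0 := by positivity
  have hQ : Q1 ≠ 0 := by
    rintro rfl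
    have : q ^ (n + 1) * q ^ Bc e ≠ 0 := by positivity
    simp [← hq'] at this
  generalize p ^ (n + 1) = P2 at *
  generalize q ^ (n + 1) = Q2 at *
  field_simp
  linear_combination (1 - p - q) * (1 - π0) * v * (q ^ Gc e * Q1 * hp' + p ^ Gc e * P1 * hq')

theorem treeSurplus_nonpos (e : Ev) : treeSurplus p q π0 e ≤ 0 :=
  mul_nonpos_of_nonneg_of_nonpos (h.scale_pos e).le (h.excess_nonpos _)

theorem summable_treeSurplus : Summable (treeSurplus p q π0) := by
  have hd : 0 < 1 - p - q := by linarith [h.add_lt_one]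
  have hs : Summable fun e => (1 - p - q)⁻¹ * (FG p q e * π0 + FB p q e * (1 - π0)) :=
    ((h.summable_FG.mul_right _).add (h.summable_FB.mul_right _)).mul_left _
  refine Summable.of_norm_bounded hs fun e => ?_
  have h1 := h.good_eq_scale e
  have h2 := h.bad_eq_scale e
  have h3 := h.abs_excess_le (drawdown e + 1)
  rw [treeSurplus, Real.norm_eq_abs, abs_mul, abs_of_pos (h.scale_pos e),
    inv_mul_eq_div, le_div_iff₀ hd]
  have h4 := mul_le_mul_of_nonneg_left h3 (mul_pos hd (h.scale_pos e)).le
  have h5 : FG p q e * π0 * (1 - V p q π0 e) ≤ FG p q e * π0 :=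
    mul_le_of_le_one_right (mul_pos (h.FG_pos e) h.prior_pos).le (by linarith [h.V_pos e])
  have h6 : FB p q e * (1 - π0) * V p q π0 e ≤ FB p q e * (1 - π0) :=
    mul_le_of_le_one_right (mul_pos (h.FB_pos e) (sub_pos.2 h.prior_lt_one)).le (h.V_lt_one e).le
  linarith

theorem surplus_eq (e : Ev) : surplus p q π0 (V p q π0 e) e =
    treeSurplus p q π0 e - treeSurplus p q π0 (true :: e) - treeSurplus p q π0 (false :: e) := by
  have hq := h.q_pos.ne'
  have ha := (sub_pos.2 h.alpha_lt_p).ne'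
  have hrec := h.excess_rec (drawdown e)
  have hf : treeSurplus p q π0 (false :: e) =
      scale p q π0 e * excess p q (drawdown e + 2) := by
    rw [treeSurplus, scale, scale, drawdown_false, V_congr (N_false e), Gc_false, Bc_false]
    field_simp
    ring
  have ht : treeSurplus p q π0 (true :: e) =
      scale p q π0 e * (p * q * excess p q (drawdown e)) := by
    rcases Nat.eq_zero_or_pos (drawdown e) with h0 | h0
    · rw [h0, excess_zero, mul_zero, mul_zero]
      exact treeSurplus_eq_zero (by rw [drawdown_true, h0])
    · rw [treeSurplus, scale, scale, drawdown_true, V_congr (N_true_of_pos h0.ne'), Gc_true,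
        Bc_true]
      obtain ⟨k, hk⟩ := Nat.exists_eq_add_of_lt h0
      rw [hk, show 0 + k + 1 - 1 + 1 = 0 + k + 1 by omega]
      field_simp
      ring
  rw [hf, ht, treeSurplus, hrec, surplus, h.good_eq_scale, h.bad_eq_scale]
  ring

end Admissible

/-! ### Signed sums of the surplus -/

namespace Admissible

variable {p q π0 : ℝ} (h : Admissible p q π0)
include h

theorem summable_surplus_V : Summable fun e => surplus p q π0 (V p q π0 e) e := by
  have hs := h.summable_treeSurplus
  simp only [h.surplus_eq]
  exact (hasSum_telescope hs).summable

theorem summable_indicator_treeSurplus (W : Set Ev) :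
    Summable (W.indicator (treeSurplus p q π0)) :=
  h.summable_treeSurplus.indicator W

theorem tsum_surplus_nonneg {W : Set Ev}
    (hW : ∀ x l, V p q π0 (x :: l) = V p q π0 l → x :: l ∈ W → l ∈ W) :
    0 ≤ ∑' e, W.indicator (fun e => surplus p q π0 (V p q π0 e) e) e := by
  classical
  have ht := hasSum_telescope (h.summable_indicator_treeSurplus W)
  have h0 : W.indicator (treeSurplus p q π0) [] = 0 := by
    simp [Set.indicator_apply, treeSurplus_nil]
  rw [h0] at ht
  rw [← ht.tsum_eq]
  refine Summable.tsum_le_tsum (fun l => ?_) ht.summable (h.summable_surplus_V.indicator W)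
  have key (x : Bool) : W.indicator (fun _ => treeSurplus p q π0 (x :: l)) l ≤
      W.indicator (treeSurplus p q π0) (x :: l) := by
    have hn := h.treeSurplus_nonpos (x :: l)
    by_cases hz : treeSurplus p q π0 (x :: l) = 0
    · simp [Set.indicator_apply, hz]
    · have := hW x l (V_cons_of_treeSurplus_ne_zero hz)
      simp only [Set.indicator_apply]
      split_ifs <;> tauto
  have h1 := key true
  have h2 := key false
  simp only [Set.indicator_apply, h.surplus_eq] at *
  split_ifs at * <;> linarith

theorem tsum_surplus_nonpos {W : Set Ev}
    (hW : ∀ x l, V p q π0 (x :: l) = V p q π0 l → l ∈ W → x :: l ∈ W) :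
    ∑' e, W.indicator (fun e => surplus p q π0 (V p q π0 e) e) e ≤ 0 := by
  have hc := h.tsum_surplus_nonneg (W := Wᶜ) fun x l hxl hx hl => hx (hW x l hxl hl)
  have hu := h.tsum_surplus_nonneg (W := Set.univ) fun _ _ _ _ => trivial
  have ht := hasSum_telescope h.summable_treeSurplus
  rw [treeSurplus_nil] at ht
  have e1 := Summable.tsum_add (h.summable_surplus_V.indicator W)
    (h.summable_surplus_V.indicator Wᶜ)
  have e2 : ∑' e, (W.indicator (fun e => surplus p q π0 (V p q π0 e) e) e +
      Wᶜ.indicator (fun e => surplus p q π0 (V p q π0 e) e) e) = 0 := by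
    rw [← ht.tsum_eq]
    refine tsum_congr fun e => ?_
    rw [Set.indicator_self_add_compl_apply, h.surplus_eq]
  linarith

theorem tsum_indicator_surplus (A : Set Ev) (x : ℝ) :
    ∑' e, A.indicator (surplus p q π0 x) e =
      (∑' e : A, FG p q e) * π0 * (1 - x) - (∑' e : A, FB p q e) * (1 - π0) * x := by
  have sG := h.summable_FG.subtype A
  have sB := h.summable_FB.subtype A
  rw [← tsum_subtype, ← tsum_mul_right, ← tsum_mul_right, ← tsum_mul_right, ← tsum_mul_right,
    ← Summable.tsum_sub]
  · rfl
  · exact (sG.mul_right _).mul_right _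
  · exact (sB.mul_right _).mul_right _

theorem nu_mass_pos {A : Set Ev} (hA : A.Nonempty) :
    0 < (∑' e : A, FG p q e) * π0 ∧ 0 < (∑' e : A, FB p q e) * (1 - π0) := by
  obtain ⟨a, ha⟩ := hA
  constructor
  · exact mul_pos ((h.summable_FG.subtype A).tsum_pos (fun i => (h.FG_pos i.1).le) ⟨a, ha⟩
      (h.FG_pos a)) h.prior_pos
  · exact mul_pos ((h.summable_FB.subtype A).tsum_pos (fun i => (h.FB_pos i.1).le) ⟨a, ha⟩
      (h.FB_pos a)) (sub_pos.2 h.prior_lt_one)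

theorem le_nu_iff {A : Set Ev} (hA : A.Nonempty) (x : ℝ) :
    x ≤ nu p q π0 A ↔ 0 ≤ ∑' e, A.indicator (surplus p q π0 x) e := by
  obtain ⟨h1, h2⟩ := h.nu_mass_pos hA
  rw [h.tsum_indicator_surplus, nu, le_div_iff₀ (by positivity)]
  constructor <;> intro _ <;> linarith

theorem nu_le_iff {A : Set Ev} (hA : A.Nonempty) (x : ℝ) :
    nu p q π0 A ≤ x ↔ ∑' e, A.indicator (surplus p q π0 x) e ≤ 0 := by
  obtain ⟨h1, h2⟩ := h.nu_mass_pos hA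
  rw [h.tsum_indicator_surplus, nu, div_le_iff₀ (by positivity)]
  constructor <;> intro _ <;> linarith

theorem nu_singleton_le_iff (e : Ev) (x : ℝ) :
    nu p q π0 {e} ≤ x ↔ surplus p q π0 x e ≤ 0 := by
  rw [h.nu_le_iff (Set.singleton_nonempty e), ← tsum_subtype, tsum_singleton]

theorem le_nu_singleton_iff (e : Ev) (x : ℝ) :
    x ≤ nu p q π0 {e} ↔ 0 ≤ surplus p q π0 x e := by
  rw [h.le_nu_iff (Set.singleton_nonempty e), ← tsum_subtype, tsum_singleton]

theorem nu_singleton_mem (e : Ev) : nu p q π0 {e} ∈ Set.Icc (0 : ℝ) 1 := by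
  constructor
  · rw [h.le_nu_singleton_iff, surplus]
    have := mul_pos (h.FG_pos e) h.prior_pos
    linarith
  · rw [h.nu_singleton_le_iff, surplus]
    have := mul_pos (h.FB_pos e) (sub_pos.2 h.prior_lt_one)
    linarith

omit h in
theorem indicator_surplus_congr {W : Set Ev} {x : ℝ} (hW : W ⊆ V p q π0 ⁻¹' {x}) :
    W.indicator (surplus p q π0 x) =
      W.indicator (fun e => surplus p q π0 (V p q π0 e) e) :=
  Set.indicator_congr fun e he => by rw [show V p q π0 e = x from hW he]

theorem nu_preimage {x : ℝ} (hx : x ∈ Set.range (V p q π0)) :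
    nu p q π0 (V p q π0 ⁻¹' {x}) = x := by
  have hne : (V p q π0 ⁻¹' {x}).Nonempty := hx
  apply le_antisymm
  · rw [h.nu_le_iff hne, indicator_surplus_congr subset_rfl]
    exact h.tsum_surplus_nonpos fun y l hyl hl => by simpa [hyl] using hl
  · rw [h.le_nu_iff hne, indicator_surplus_congr subset_rfl]
    exact h.tsum_surplus_nonneg fun y l hyl hl => by simpa [hyl] using hl

theorem le_nu_of_isLCS {x : ℝ} {L : Set Ev} (hL : IsLCS (V p q π0 ⁻¹' {x}) L) :
    x ≤ nu p q π0 L := by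
  obtain ⟨hne, hsub, hlow⟩ := hL
  rw [h.le_nu_iff hne, indicator_surplus_congr hsub]
  refine h.tsum_surplus_nonneg fun y l hyl hl => hlow _ hl l ?_ (List.suffix_cons y l)
  simpa [hyl] using hsub hl

end Admissible

/-! ### An equilibrium -/

/-- The fraction of the pooled mass that `e` passes on to its longest proper suffix. -/
noncomputable def passFraction (p q π0 : ℝ) (e : Ev) : ℝ :=
  if 0 ≤ surplus p q π0 (V p q π0 e) e then
    treeSurplus p q π0 e / (treeSurplus p q π0 e - surplus p q π0 (V p q π0 e) e)
  else 1

/-- The distribution over messages of a type pooling from `e` downwards. -/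
noncomputable def pool (p q π0 : ℝ) : Ev → Ev → ℝ
  | [], m => if m = [] then 1 else 0
  | x :: l, m =>
    (1 - passFraction p q π0 (x :: l)) * (if m = x :: l then 1 else 0) +
      passFraction p q π0 (x :: l) * pool p q π0 l m

/-- The sender's strategy: truth-telling with a nonnegative surplus, pooling otherwise. -/
noncomputable def strategy (p q π0 : ℝ) (e m : Ev) : ℝ :=
  if 0 ≤ surplus p q π0 (V p q π0 e) e then (if m = e then 1 else 0) else pool p q π0 e m

/-- The surplus pooled on `m` that comes from the part of the tree at and above `e`. -/
noncomputable def carried (p q π0 : ℝ) (m : Ev) : Ev → ℝ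
  | [] => 0
  | x :: l => pool p q π0 l m * treeSurplus p q π0 (x :: l)

/-- The receiver's response to the strategy. -/
noncomputable def response (p q π0 : ℝ) (m : Ev) : ℝ :=
  if 0 ≤ surplus p q π0 (V p q π0 m) m then V p q π0 m else nu p q π0 {m}

namespace Admissible

variable {p q π0 : ℝ} (h : Admissible p q π0)
include h

theorem passFraction_nonneg (e : Ev) : 0 ≤ passFraction p q π0 e := by
  have := h.treeSurplus_nonpos e
  unfold passFraction
  split_ifs
  · exact div_nonneg_of_nonpos this (by linarith)
  · exact zero_le_one

theorem passFraction_le_one (e : Ev) : passFraction p q π0 e ≤ 1 := by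
  have := h.treeSurplus_nonpos e
  unfold passFraction
  split_ifs
  · exact div_le_one_of_ge (by linarith) (by linarith)
  · exact le_rfl

theorem surplus_nonneg_of_treeSurplus {e : Ev} (he : treeSurplus p q π0 e = 0) :
    0 ≤ surplus p q π0 (V p q π0 e) e := by
  have h1 := h.treeSurplus_nonpos (true :: e)
  have h2 := h.treeSurplus_nonpos (false :: e)
  rw [h.surplus_eq, he]
  linarith

theorem V_cons_of_passFraction_ne_zero {x : Bool} {l : Ev}
    (he : passFraction p q π0 (x :: l) ≠ 0) : V p q π0 (x :: l) = V p q π0 l := by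
  refine V_cons_of_treeSurplus_ne_zero fun h0 => he ?_
  rw [passFraction, if_pos (h.surplus_nonneg_of_treeSurplus h0), h0, zero_div]

theorem pool_nonneg (e m : Ev) : 0 ≤ pool p q π0 e m := by
  induction e with
  | nil => unfold pool; split_ifs <;> norm_num
  | cons x l ih =>
    have h1 := h.passFraction_nonneg (x :: l)
    have h2 := sub_nonneg.2 (h.passFraction_le_one (x :: l))
    unfold pool
    split_ifs <;> positivity

omit h in
theorem hasSum_pool (e : Ev) : HasSum (pool p q π0 e) 1 := by
  induction e with
  | nil => exact hasSum_ite_eq ([] : Ev) (1 : ℝ)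
  | cons x l ih =>
    have hsum := ((hasSum_ite_eq (x :: l) (1 : ℝ)).mul_left
      (1 - passFraction p q π0 (x :: l))).add (ih.mul_left (passFraction p q π0 (x :: l)))
    rwa [mul_one, mul_one, sub_add_cancel] at hsum

omit h in
theorem pool_eq_zero_of_not_suffix {e m : Ev} (hm : ¬ m <:+ e) : pool p q π0 e m = 0 := by
  induction e with
  | nil =>
    rw [pool, if_neg]
    rintro rfl
    exact hm List.suffix_rfl
  | cons x l ih =>
    rw [pool, if_neg, ih]
    · ring
    · exact fun hl => hm (hl.trans (List.suffix_cons x l))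
    · rintro rfl
      exact hm List.suffix_rfl

theorem good_of_pool_ne_zero {e m : Ev} (hm : pool p q π0 e m ≠ 0) :
    V p q π0 m = V p q π0 e ∧ 0 ≤ surplus p q π0 (V p q π0 m) m := by
  induction e with
  | nil =>
    have : m = [] := by
      by_contra hne
      rw [pool, if_neg hne] at hm
      exact hm rfl
    subst this
    exact ⟨rfl, h.surplus_nonneg_of_treeSurplus (treeSurplus_nil _ _ _)⟩
  | cons x l ih =>
    rw [pool] at hm
    by_cases h1 : passFraction p q π0 (x :: l) * pool p q π0 l m = 0
    · rw [h1, add_zero] at hm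
      have hm1 := left_ne_zero_of_mul hm
      have hm2 : m = x :: l := by
        by_contra hne
        rw [if_neg hne, mul_zero] at hm
        exact hm rfl
      subst hm2
      refine ⟨rfl, ?_⟩
      by_contra hb
      rw [passFraction, if_neg hb] at hm1
      exact hm1 (sub_self 1)
    · obtain ⟨h2, h3⟩ := ih (right_ne_zero_of_mul h1)
      exact ⟨h2.trans (h.V_cons_of_passFraction_ne_zero (left_ne_zero_of_mul h1)).symm, h3⟩

theorem strategy_nonneg (e m : Ev) : 0 ≤ strategy p q π0 e m := by
  unfold strategy
  split_ifs
  · exact zero_le_one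
  · exact le_rfl
  · exact h.pool_nonneg e m

omit h in
theorem strategy_self {e : Ev} (he : 0 ≤ surplus p q π0 (V p q π0 e) e) :
    strategy p q π0 e e = 1 := by
  rw [strategy, if_pos he, if_pos rfl]

theorem good_of_strategy_ne_zero {e m : Ev} (hm : strategy p q π0 e m ≠ 0) :
    V p q π0 m = V p q π0 e ∧ 0 ≤ surplus p q π0 (V p q π0 m) m ∧ m <:+ e := by
  unfold strategy at hm
  split_ifs at hm with h1 h2
  · subst h2
    exact ⟨rfl, h1, List.suffix_rfl⟩
  · exact absurd rfl hm
  · obtain ⟨h2, h3⟩ := h.good_of_pool_ne_zero hm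
    refine ⟨h2, h3, ?_⟩
    by_contra hs
    exact hm (pool_eq_zero_of_not_suffix hs)

omit h in
theorem hasSum_strategy (e : Ev) : HasSum (strategy p q π0 e) 1 := by
  by_cases h1 : 0 ≤ surplus p q π0 (V p q π0 e) e
  · exact (hasSum_ite_eq e (1 : ℝ)).congr_fun fun m => by rw [strategy, if_pos h1]
  · exact (hasSum_pool e).congr_fun fun m => by rw [strategy, if_neg h1]

theorem strategy_le_one (e m : Ev) : strategy p q π0 e m ≤ 1 :=
  le_hasSum (hasSum_strategy e) m fun _ _ => h.strategy_nonneg e _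

theorem pool_le_one (e m : Ev) : pool p q π0 e m ≤ 1 :=
  le_hasSum (hasSum_pool e) m fun _ _ => h.pool_nonneg e _

theorem passFraction_mul {e : Ev} (he : 0 ≤ surplus p q π0 (V p q π0 e) e) :
    passFraction p q π0 e *
      (treeSurplus p q π0 (true :: e) + treeSurplus p q π0 (false :: e)) =
        treeSurplus p q π0 e := by
  have hS := h.treeSurplus_nonpos e
  have hsum : treeSurplus p q π0 (true :: e) + treeSurplus p q π0 (false :: e) =
      treeSurplus p q π0 e - surplus p q π0 (V p q π0 e) e := by
    rw [h.surplus_eq]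
    ring
  rw [passFraction, if_pos he, hsum]
  refine div_mul_cancel_of_imp fun h0 => ?_
  linarith

theorem strategy_mul_surplus (e m : Ev) :
    strategy p q π0 e m * surplus p q π0 (V p q π0 m) e =
      carried p q π0 m e - carried p q π0 m (true :: e) - carried p q π0 m (false :: e) := by
  have hV : strategy p q π0 e m * surplus p q π0 (V p q π0 m) e =
      strategy p q π0 e m * surplus p q π0 (V p q π0 e) e := by
    by_cases h0 : strategy p q π0 e m = 0
    · rw [h0, zero_mul, zero_mul]
    · rw [(h.good_of_strategy_ne_zero h0).1]
  rw [hV]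
  cases e with
  | nil =>
    have hg := h.surplus_nonneg_of_treeSurplus (treeSurplus_nil p q π0)
    rw [strategy, if_pos hg, h.surplus_eq, treeSurplus_nil]
    simp only [carried, pool]
    ring
  | cons x l =>
    simp only [carried]
    by_cases hg : 0 ≤ surplus p q π0 (V p q π0 (x :: l)) (x :: l)
    · have hp := h.passFraction_mul hg
      rw [strategy, if_pos hg, h.surplus_eq, pool]
      split_ifs with hm
      · have hl : pool p q π0 l m = 0 := by
          refine pool_eq_zero_of_not_suffix fun hs => ?_
          have := hs.length_le
          simp [hm] at this
        rw [hl]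
        linear_combination -hp
      · linear_combination pool p q π0 l m * hp
    · rw [strategy, if_neg hg, h.surplus_eq, pool, passFraction, if_neg hg]
      ring

theorem hasSum_strategy_mul_surplus (m : Ev) :
    HasSum (fun e => strategy p q π0 e m * surplus p q π0 (V p q π0 m) e) 0 := by
  have hs : Summable (carried p q π0 m) := by
    refine Summable.of_norm_bounded h.summable_treeSurplus.norm fun e => ?_
    cases e with
    | nil => simp [carried]
    | cons x l =>
      rw [carried, norm_mul]
      refine mul_le_of_le_one_left (norm_nonneg _) ?_
      rw [Real.norm_of_nonneg (h.pool_nonneg l m)]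
      exact h.pool_le_one l m
  have ht := hasSum_telescope hs
  simp only [← h.strategy_mul_surplus] at ht
  exact ht

/-- Bayes' rule as a balance of surpluses. -/
theorem bayes_iff {s : Ev → ℝ} {m : Ev} (x : ℝ) (hs0 : ∀ e, 0 ≤ s e) (hs1 : ∀ e, s e ≤ 1)
    (hsm : ∀ e, 0 < s e → m <:+ e) (hpos : ∃ e, 0 < s e) :
    x = (∑' e : {e : Ev // m <:+ e}, s e.1 * FG p q e.1 * π0) /
      (∑' e : {e : Ev // m <:+ e}, s e.1 * (FG p q e.1 * π0 + FB p q e.1 * (1 - π0))) ↔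
    ∑' e, s e * surplus p q π0 x e = 0 := by
  have hsupp : Function.support s ⊆ {e : Ev | m <:+ e} :=
    fun e he => hsm e ((hs0 e).lt_of_ne' he)
  have sG : Summable fun e => s e * FG p q e * π0 := by
    refine Summable.of_nonneg_of_le (fun e => ?_) (fun e => ?_) (h.summable_FG.mul_right π0)
    · exact mul_nonneg (mul_nonneg (hs0 e) (h.FG_pos e).le) h.prior_pos.le
    · exact mul_le_mul_of_nonneg_right (mul_le_of_le_one_left (h.FG_pos e).le (hs1 e))
        h.prior_pos.le
  have sB : Summable fun e => s e * FB p q e * (1 - π0) := by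
    have hp := (sub_pos.2 h.prior_lt_one).le
    refine Summable.of_nonneg_of_le (fun e => ?_) (fun e => ?_)
      (h.summable_FB.mul_right (1 - π0))
    · exact mul_nonneg (mul_nonneg (hs0 e) (h.FB_pos e).le) hp
    · exact mul_le_mul_of_nonneg_right (mul_le_of_le_one_left (h.FB_pos e).le (hs1 e)) hp
  have sT : Summable fun e => s e * (FG p q e * π0 + FB p q e * (1 - π0)) :=
    (sG.add sB).congr fun e => by ring
  have e1 : ∑' e : {e : Ev // m <:+ e}, s e.1 * FG p q e.1 * π0 =
      ∑' e, s e * FG p q e * π0 :=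
    tsum_subtype_eq_of_support_subset (f := fun e => s e * FG p q e * π0) fun e he =>
      hsupp (left_ne_zero_of_mul (left_ne_zero_of_mul he))
  have e2 : ∑' e : {e : Ev // m <:+ e}, s e.1 * (FG p q e.1 * π0 + FB p q e.1 * (1 - π0)) =
      ∑' e, s e * (FG p q e * π0 + FB p q e * (1 - π0)) :=
    tsum_subtype_eq_of_support_subset
      (f := fun e => s e * (FG p q e * π0 + FB p q e * (1 - π0))) fun e he =>
        hsupp (left_ne_zero_of_mul he)
  have hT (e : Ev) : 0 < FG p q e * π0 + FB p q e * (1 - π0) :=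
    add_pos (mul_pos (h.FG_pos e) h.prior_pos)
      (mul_pos (h.FB_pos e) (sub_pos.2 h.prior_lt_one))
  have hpos' : 0 < ∑' e, s e * (FG p q e * π0 + FB p q e * (1 - π0)) := by
    obtain ⟨e, he⟩ := hpos
    exact sT.tsum_pos (fun e => mul_nonneg (hs0 e) (hT e).le) e (mul_pos he (hT e))
  have e3 : ∑' e, s e * surplus p q π0 x e = ∑' e, s e * FG p q e * π0 -
      x * ∑' e, s e * (FG p q e * π0 + FB p q e * (1 - π0)) := by
    rw [← tsum_mul_left, ← Summable.tsum_sub sG (sT.mul_left x)]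
    exact tsum_congr fun e => by rw [surplus]; ring
  rw [e1, e2, e3, eq_div_iff hpos'.ne', sub_eq_zero, eq_comm]

theorem response_le_V (m : Ev) : response p q π0 m ≤ V p q π0 m := by
  unfold response
  split_ifs with hg
  · exact le_rfl
  · exact (h.nu_singleton_le_iff m _).2 (not_le.1 hg).le

theorem response_eq_of_strategy_pos {e m : Ev} (hm : 0 < strategy p q π0 e m) :
    response p q π0 m = V p q π0 e := by
  obtain ⟨h1, h2, -⟩ := h.good_of_strategy_ne_zero hm.ne'
  rw [response, if_pos h2, h1]

/-- The truth-leaning equilibrium in which surplus is pooled downwards. -/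
noncomputable def equilibrium : Eqm p q π0 where
  σ := strategy p q π0
  act := response p q π0
  μ := response p q π0
  σ_nonneg := h.strategy_nonneg
  σ_hasSum := hasSum_strategy
  feasible e m hm := (h.good_of_strategy_ne_zero hm.ne').2.2
  μ_mem m := by
    unfold response
    split_ifs
    · exact ⟨(h.V_pos m).le, (h.V_lt_one m).le⟩
    · exact h.nu_singleton_mem m
  sender_opt e m hm m' hm' := by
    rw [h.response_eq_of_strategy_pos hm]
    exact (h.response_le_V m').trans (h.V_mono hm')
  receiver_opt _ := rfl
  bayes m hm := by
    rw [h.bayes_iff _ (fun e => h.strategy_nonneg e m) (fun e => h.strategy_le_one e m)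
      (fun e he => (h.good_of_strategy_ne_zero he.ne').2.2) hm]
    obtain ⟨e, he⟩ := hm
    rw [response, if_pos (h.good_of_strategy_ne_zero he.ne').2.1]
    exact (h.hasSum_strategy_mul_surplus m).tsum_eq
  truth_leaning e he := by
    refine strategy_self ?_
    by_contra hg
    obtain ⟨m, hm⟩ : ∃ m, strategy p q π0 e m ≠ 0 := by
      by_contra! h0
      have hsum := hasSum_strategy (p := p) (q := q) (π0 := π0) e
      rw [show strategy p q π0 e = fun _ => 0 from funext h0] at hsum
      exact zero_ne_one (hasSum_zero.unique hsum)
    obtain ⟨h1, h2, h3⟩ := h.good_of_strategy_ne_zero hm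
    have h4 := he m h3
    rw [response, if_pos h2, response, if_neg hg, h1, h.le_nu_singleton_iff] at h4
    exact hg h4
  offpath m hm := by
    rw [response, if_neg]
    intro hg
    exact hm ⟨m, by rw [strategy_self hg]; exact one_pos⟩

end Admissible

/-! ### Uniqueness of the value function -/

namespace Eqm

variable {p q π0 : ℝ} (Q : Eqm p q π0)

theorem exists_message (e : Ev) : ∃ m, 0 < Q.σ e m := by
  by_contra! h0
  have hsum := Q.σ_hasSum e
  rw [show Q.σ e = fun _ => 0 from funext fun m => (h0 m).antisymm (Q.σ_nonneg e m)] at hsum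
  exact zero_ne_one (hasSum_zero.unique hsum)

/-- The sender's payoff. -/
noncomputable def value (e : Ev) : ℝ := Q.act (Q.exists_message e).choose

theorem value_mem (e : Ev) : Q.value e ∈ Set.Icc (0 : ℝ) 1 := by
  rw [value, Q.receiver_opt]
  exact Q.μ_mem _

theorem act_le_value {e m : Ev} (hm : m <:+ e) : Q.act m ≤ Q.value e :=
  Q.sender_opt e _ (Q.exists_message e).choose_spec m hm

theorem act_eq_value {e m : Ev} (hm : 0 < Q.σ e m) : Q.act m = Q.value e :=
  (Q.act_le_value (Q.feasible e m hm)).antisymm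
    (Q.sender_opt e m hm _ (Q.feasible e _ (Q.exists_message e).choose_spec))

theorem value_mono {m e : Ev} (hme : m <:+ e) : Q.value m ≤ Q.value e :=
  Q.act_le_value ((Q.feasible m _ (Q.exists_message m).choose_spec).trans hme)

theorem value_message {e m : Ev} (hm : 0 < Q.σ e m) : Q.value m = Q.value e := by
  refine (Q.value_mono (Q.feasible e m hm)).antisymm ?_
  rw [← Q.act_eq_value hm]
  exact Q.act_le_value List.suffix_rfl

theorem σ_le_one (e m : Ev) : Q.σ e m ≤ 1 :=
  le_hasSum (Q.σ_hasSum e) m fun _ _ => Q.σ_nonneg e _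

theorem self_of_message {e m : Ev} (hm : 0 < Q.σ e m) : Q.σ m m = 1 := by
  refine Q.truth_leaning m fun m' hm' => ?_
  rw [Q.act_eq_value hm]
  exact Q.act_le_value (hm'.trans (Q.feasible e m hm))

theorem eq_zero_of_self {e m : Ev} (he : Q.σ e e = 1) (hm : m ≠ e) : Q.σ e m = 0 := by
  have hle := sum_le_hasSum {e, m} (fun i _ => Q.σ_nonneg e i) (Q.σ_hasSum e)
  rw [Finset.sum_pair hm.symm, he] at hle
  linarith [Q.σ_nonneg e m]

variable (h : Admissible p q π0)
include h

theorem surplus_nonpos {e m : Ev} (hm : 0 < Q.σ e m) (hne : m ≠ e) :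
    surplus p q π0 (Q.value e) e ≤ 0 := by
  have hoff : ¬ ∃ e', 0 < Q.σ e' e := fun ⟨_, he'⟩ =>
    hm.ne' (Q.eq_zero_of_self (Q.self_of_message he') hne)
  rw [← h.nu_singleton_le_iff, ← Q.offpath e hoff, ← Q.receiver_opt]
  exact Q.act_le_value List.suffix_rfl

theorem abs_surplus_le {x : ℝ} (hx : x ∈ Set.Icc (0 : ℝ) 1) (e : Ev) :
    ‖surplus p q π0 x e‖ ≤ FG p q e * π0 + FB p q e * (1 - π0) := by
  have h1 := mul_pos (h.FG_pos e) h.prior_pos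
  have h2 := mul_pos (h.FB_pos e) (sub_pos.2 h.prior_lt_one)
  have h3 := mul_nonneg h1.le hx.1
  have h4 := mul_nonneg h2.le hx.1
  have h5 := mul_nonneg h1.le (sub_nonneg.2 hx.2)
  have h6 := mul_nonneg h2.le (sub_nonneg.2 hx.2)
  rw [Real.norm_eq_abs, abs_le, surplus]
  constructor <;> linarith

theorem summable_surplus_value : Summable fun e => surplus p q π0 (Q.value e) e :=
  Summable.of_norm_bounded ((h.summable_FG.mul_right _).add (h.summable_FB.mul_right _))
    fun e => abs_surplus_le h (Q.value_mem e) e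

theorem tsum_message_surplus (m : Ev) :
    ∑' e, Q.σ e m * surplus p q π0 (Q.value e) e = 0 := by
  by_cases hm : ∃ e, 0 < Q.σ e m
  · rw [← (h.bayes_iff (Q.μ m) (fun e => Q.σ_nonneg e m) (fun e => Q.σ_le_one e m)
      (fun e he => Q.feasible e m he) hm).1 (Q.bayes m hm)]
    refine tsum_congr fun e => ?_
    rcases (Q.σ_nonneg e m).eq_or_lt with h0 | h0
    · rw [← h0, zero_mul, zero_mul]
    · rw [← Q.receiver_opt, Q.act_eq_value h0]
  · push Not at hm
    have h0 (e : Ev) : Q.σ e m = 0 := (hm e).antisymm (Q.σ_nonneg e m)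
    simp [h0]

omit h in
theorem summable_σ_mul {f : Ev → ℝ} (hf : Summable f) (m : Ev) :
    Summable fun e => Q.σ e m * f e :=
  Summable.of_norm_bounded hf.norm fun e => by
    rw [norm_mul, Real.norm_of_nonneg (Q.σ_nonneg e m)]
    exact mul_le_of_le_one_left (norm_nonneg _) (Q.σ_le_one e m)

omit h in
/-- Sums over types may be computed message by message. -/
theorem tsum_eq_tsum_messages {f : Ev → ℝ} (hf : Summable f) :
    ∑' e, f e = ∑' m, ∑' e, Q.σ e m * f e := by
  have hs : Summable (Function.uncurry fun e m => Q.σ e m * f e) := by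
    refine Summable.of_norm ((summable_prod_of_nonneg fun _ => norm_nonneg _).2 ⟨fun e => ?_, ?_⟩)
    · exact ((Q.σ_hasSum e).summable.mul_right (f e)).norm
    · refine hf.norm.congr fun e => ?_
      have := ((Q.σ_hasSum e).mul_right ‖f e‖).tsum_eq
      rw [one_mul] at this
      rw [← this]
      refine tsum_congr fun m => ?_
      simp [abs_of_nonneg (Q.σ_nonneg e m)]
  rw [hs.tsum_comm]
  refine tsum_congr fun e => ?_
  rw [tsum_mul_right, (Q.σ_hasSum e).tsum_eq, one_mul]

theorem tsum_value_surplus_nonneg {W : Set Ev} (hW : ∀ e m, 0 < Q.σ e m → e ∈ W → m ∈ W) :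
    0 ≤ ∑' e, W.indicator (fun e => surplus p q π0 (Q.value e) e) e := by
  have hs := Q.summable_surplus_value h
  rw [Q.tsum_eq_tsum_messages (hs.indicator W)]
  refine tsum_nonneg fun m => ?_
  by_cases hm : m ∈ W
  · rw [← Q.tsum_message_surplus h m]
    refine Summable.tsum_le_tsum (fun e => ?_) (Q.summable_σ_mul hs m)
      (Q.summable_σ_mul (hs.indicator W) m)
    by_cases he : e ∈ W
    · rw [Set.indicator_of_mem he]
    · rw [Set.indicator_of_notMem he, mul_zero]
      rcases (Q.σ_nonneg e m).eq_or_lt with h0 | h0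
      · rw [← h0, zero_mul]
      · exact mul_nonpos_of_nonneg_of_nonpos h0.le
          (Q.surplus_nonpos h h0 fun hme => he (hme ▸ hm))
  · refine tsum_nonneg fun e => le_of_eq ?_
    rcases (Q.σ_nonneg e m).eq_or_lt with h0 | h0
    · rw [← h0, zero_mul]
    · rw [Set.indicator_of_notMem fun he => hm (hW e m h0 he), mul_zero]

theorem tsum_value_surplus_nonpos {W : Set Ev} (hW : ∀ e m, 0 < Q.σ e m → m ∈ W → e ∈ W) :
    ∑' e, W.indicator (fun e => surplus p q π0 (Q.value e) e) e ≤ 0 := by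
  have hs := Q.summable_surplus_value h
  have hc := Q.tsum_value_surplus_nonneg h (W := Wᶜ) fun e m hm he hmW => he (hW e m hm hmW)
  have htot : ∑' e, surplus p q π0 (Q.value e) e = 0 := by
    rw [Q.tsum_eq_tsum_messages hs]
    simp only [Q.tsum_message_surplus h, tsum_zero]
  have hadd := Summable.tsum_add (hs.indicator W) (hs.indicator Wᶜ)
  simp only [Set.indicator_self_add_compl_apply] at hadd
  linarith

omit Q in
theorem surplus_lt_surplus {x y : ℝ} (hxy : x < y) (e : Ev) :
    surplus p q π0 y e < surplus p q π0 x e := by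
  have h1 := mul_lt_mul_of_pos_left hxy (mul_pos (h.FG_pos e) h.prior_pos)
  have h2 := mul_lt_mul_of_pos_left hxy (mul_pos (h.FB_pos e) (sub_pos.2 h.prior_lt_one))
  unfold surplus
  linarith

omit Q in
/-- A set on which the belief `u` exceeds `v` carries more surplus relative to `v`. -/
theorem eq_empty_of_tsum_surplus_le {u v : Ev → ℝ} {W : Set Ev}
    (hu : Summable fun e => surplus p q π0 (u e) e)
    (hv : Summable fun e => surplus p q π0 (v e) e) (hW : ∀ e ∈ W, v e < u e)
    (hle : ∑' e, W.indicator (fun e => surplus p q π0 (v e) e) e ≤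
      ∑' e, W.indicator (fun e => surplus p q π0 (u e) e) e) : W = ∅ := by
  by_contra hne
  obtain ⟨a, ha⟩ := Set.nonempty_iff_ne_empty.2 hne
  refine hle.not_gt (Summable.tsum_lt_tsum (i := a) (fun e => ?_) ?_ (hu.indicator W)
    (hv.indicator W))
  · by_cases he : e ∈ W
    · exact Set.indicator_le_indicator (surplus_lt_surplus h (hW e he) e).le
    · rw [Set.indicator_of_notMem he, Set.indicator_of_notMem he]
  · rw [Set.indicator_of_mem ha, Set.indicator_of_mem ha]
    exact surplus_lt_surplus h (hW a ha) a

theorem value_eq_V : Q.value = V p q π0 := by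
  have hgt : {e | V p q π0 e < Q.value e} = ∅ := by
    refine eq_empty_of_tsum_surplus_le h (Q.summable_surplus_value h) h.summable_surplus_V
      (fun _ he => he) (le_trans (h.tsum_surplus_nonpos fun x l hxl hl => ?_)
        (Q.tsum_value_surplus_nonneg h fun e m hm he => ?_))
    · exact hxl.trans_lt (lt_of_lt_of_le hl (Q.value_mono (List.suffix_cons x l)))
    · exact ((h.V_mono (Q.feasible e m hm)).trans_lt he).trans_eq (Q.value_message hm).symm
  have hlt : {e | Q.value e < V p q π0 e} = ∅ := by
    refine eq_empty_of_tsum_surplus_le h h.summable_surplus_V (Q.summable_surplus_value h)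
      (fun _ he => he) (le_trans (Q.tsum_value_surplus_nonpos h fun e m hm he => ?_)
        (h.tsum_surplus_nonneg fun x l hxl hl => ?_))
    · exact (Q.value_message hm).symm.trans_lt
        (lt_of_lt_of_le he (h.V_mono (Q.feasible e m hm)))
    · exact ((Q.value_mono (List.suffix_cons x l)).trans_lt hl).trans_eq hxl
  ext e
  exact le_antisymm (not_lt.1 fun he => (hgt ▸ he : e ∈ (∅ : Set Ev)))
    (not_lt.1 fun he => (hlt ▸ he : e ∈ (∅ : Set Ev)))

end Eqm

/-- Proposition 4: in the left-censored model, `V` satisfies the Theorem-1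
conditions (with `ξ = ν` since `φ` is the identity); consequently a
truth-leaning equilibrium exists and `V` is the sender's value function in
every truth-leaning equilibrium. -/
theorem stmt_10 (p q π0 : ℝ) (hq0 : 0 < q) (hqp : q < p) (hp1 : p < 1)
    (hpq0 : 0 < p + q) (hpq1 : p + q < 1) (h0 : 0 < π0) (h1 : π0 < 1) :
    (∀ m e : Ev, m <:+ e → V p q π0 m ≤ V p q π0 e) ∧
    (∀ x ∈ Set.range (V p q π0), nu p q π0 (V p q π0 ⁻¹' {x}) = x) ∧
    (∀ x ∈ Set.range (V p q π0), ∀ L : Set Ev,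
      IsLCS (V p q π0 ⁻¹' {x}) L → x ≤ nu p q π0 L) ∧
    (∃ Q : Eqm p q π0, ∀ e m, 0 < Q.σ e m → Q.act m = V p q π0 e) ∧
    (∀ Q : Eqm p q π0, ∀ e m, 0 < Q.σ e m → Q.act m = V p q π0 e) := by
  have h : Admissible p q π0 := ⟨hq0, hqp, hpq1, h0, h1⟩
  refine ⟨fun _ _ => h.V_mono, fun _ => h.nu_preimage, fun _ _ _ => h.le_nu_of_isLCS,
    ⟨h.equilibrium, fun _ _ => h.response_eq_of_strategy_pos⟩, fun Q e m hm => ?_⟩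
  rw [Q.act_eq_value hm, Q.value_eq_V h]

end LeftCensored
end

section
/- In the left-censored disclosure model, let n* = log_{p/q}((p−α)/(q−α)) − 1. Then n* > 0, and for every e ∈ E: ν({e}) ≥ V(e) if and only if D(e) ≥ N(e) − n*. -/
open scoped BigOperators

namespace LeftCensored

/-- `n* = log_{p/q}((p−α)/(q−α)) − 1`. -/
noncomputable def nstar (p q : ℝ) : ℝ :=
  Real.log ((p - alpha p q) / (q - alpha p q)) / Real.log (p / q) - 1

/-- The root `α` lies strictly between `0` and `q`. -/
lemma alpha_mem_Ioo {p q : ℝ} (hq0 : 0 < q) (hp0 : 0 < p) (hpq1 : p + q < 1) :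
    alpha p q ∈ Set.Ioo 0 q := by
  have hpq : 0 < p * q := mul_pos hp0 hq0
  have hlt : Real.sqrt (1 - 4 * p * q) < 1 := by
    rw [Real.sqrt_lt' one_pos]
    linarith
  have hgt : 1 - 2 * q < Real.sqrt (1 - 4 * p * q) := by
    apply Real.lt_sqrt_of_sq_lt
    nlinarith [mul_pos hq0 (sub_pos.2 hpq1)]
  constructor <;> unfold alpha <;> linarith

/-- The likelihood ratio of the bad to the good state is `(q / p) ^ D(e)`. -/
lemma FB_eq_FG_mul_zpow {p q : ℝ} (hp0 : 0 < p) (hq0 : 0 < q) (e : Ev) :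
    FB p q e = FG p q e * (q / p) ^ D e := by
  rw [FB, FG, D, zpow_sub₀ (div_pos hq0 hp0).ne', zpow_natCast, zpow_natCast, div_pow, div_pow]
  field_simp

/-- The posterior after full disclosure depends only on `D(e)`. -/
lemma nu_singleton {p q π0 : ℝ} (hp0 : 0 < p) (hq0 : 0 < q) (hpq1 : p + q < 1)
    (h0 : 0 < π0) (e : Ev) :
    nu p q π0 {e} = 1 / (1 + (1 - π0) / π0 * (q / p) ^ D e) := by
  have hFG : 0 < FG p q e :=
    mul_pos (mul_pos (by linarith) (pow_pos hp0 _)) (pow_pos hq0 _)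
  rw [nu, tsum_singleton e (FG p q), tsum_singleton e (FB p q), FB_eq_FG_mul_zpow hp0 hq0]
  have hden : FG p q e * π0 + FG p q e * (q / p) ^ D e * (1 - π0) =
      FG p q e * π0 * (1 + (1 - π0) / π0 * (q / p) ^ D e) := by
    field_simp
  rw [hden, div_mul_eq_div_div, div_self (mul_pos hFG h0).ne']

/-- `n* > 0`, and `ν({e}) ≥ V(e)` iff `D(e) ≥ N(e) − n*`. -/
theorem stmt_13 (p q π0 : ℝ) (hq0 : 0 < q) (hqp : q < p) (hp1 : p < 1)
    (hpq0 : 0 < p + q) (hpq1 : p + q < 1) (h0 : 0 < π0) (h1 : π0 < 1) :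
    0 < nstar p q ∧
    ∀ e : Ev, (V p q π0 e ≤ nu p q π0 {e} ↔ (N e : ℝ) - nstar p q ≤ (D e : ℝ)) := by
  have hp0 : 0 < p := hq0.trans hqp
  obtain ⟨ha0, haq⟩ := alpha_mem_Ioo hq0 hp0 hpq1
  have hqp0 : 0 < q / p := div_pos hq0 hp0
  have hr : 1 < p / q := (one_lt_div hq0).2 hqp
  have hlog : 0 < Real.log (p / q) := Real.log_pos hr
  have hqa : 0 < q - alpha p q := sub_pos.2 haq
  have hR : 0 < (p - alpha p q) / (q - alpha p q) := div_pos (by linarith) hqa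
  constructor
  · have hlt : p / q < (p - alpha p q) / (q - alpha p q) := by
      rw [div_lt_div_iff₀ hq0 hqa]
      nlinarith [mul_pos ha0 (sub_pos.2 hqp)]
    rw [nstar, sub_pos, one_lt_div hlog]
    exact Real.log_lt_log (zero_lt_one.trans hr) hlt
  · intro e
    have hc : 0 < (1 - π0) / π0 := div_pos (sub_pos.2 h1) h0
    have hD : 0 < (q / p) ^ D e := zpow_pos hqp0 _
    have hN : 0 < (q / p) ^ (N e + 1) := zpow_pos hqp0 _
    have hinv : Real.log (q / p) = -Real.log (p / q) := by
      rw [← Real.log_inv, inv_div]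
    rw [V, nu_singleton hp0 hq0 hpq1 h0, one_div_le_one_div (by positivity) (by positivity),
      add_le_add_iff_left, mul_assoc, mul_le_mul_iff_right₀ hc,
      ← Real.log_le_log_iff hD (mul_pos hR hN), Real.log_mul hR.ne' hN.ne',
      Real.log_zpow, Real.log_zpow, hinv, nstar]
    have hkey : Real.log ((p - alpha p q) / (q - alpha p q)) =
        Real.log ((p - alpha p q) / (q - alpha p q)) / Real.log (p / q) * Real.log (p / q) :=
      (div_mul_cancel₀ _ hlog.ne').symm
    rw [hkey, mul_div_cancel_right₀ _ hlog.ne']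
    push_cast
    generalize Real.log ((p - alpha p q) / (q - alpha p q)) / Real.log (p / q) = x
    constructor <;> intro h <;> nlinarith

end LeftCensored
end
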